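/- (Corollary, consistency of the mixture-of-g-priors Bayes factors under spherically symmetric errors.) Under the consistency setup, let T be nonempty, let γ ⊆ {1,…,p} be nonempty with γ ≠ T, and fix real numbers k ≥ 0 and ν with −k < ν < 1. For each n and each nonempty δ ⊆ {1,…,p} define, on the event where R_δ² ∈ (0,1), the integral I_δ(n) = ∫₀^∞ g^{ν/2−1} (1+g^{−1})^{−k/2} (1+g)^{(n−q_δ−1)/2} (g(1−R_δ²)+1)^{−(n−1)/2} dg. Then the Bayes factor ratio I_γ(n)/I_T(n) tends to zero in probability: for every δ' > 0, lim_{n→∞} 𝒫( R_γ² and R_T² both lie in (0,1) and I_γ(n)/I_T(n) ≤ δ' ) = 1. -/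

import Mathlib

open MeasureTheory Matrix Filter ENNReal

/-- The submatrix of `X` consisting of the columns indexed by `γ`. -/
noncomputable def designSub {n p : ℕ} (X : Matrix (Fin n) (Fin p) ℝ)
    (γ : Finset (Fin p)) : Matrix (Fin n) {j // j ∈ γ} ℝ :=
  Matrix.of fun i j => X i (j : Fin p)

/-- The residual projector `Q_γ = I - X_γ(X_γᵀX_γ)⁻¹X_γᵀ` of the submodel `γ`. -/
noncomputable def residProj {n p : ℕ} (X : Matrix (Fin n) (Fin p) ℝ)
    (γ : Finset (Fin p)) : Matrix (Fin n) (Fin n) ℝ :=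
  1 - designSub X γ * ((designSub X γ)ᵀ * designSub X γ)⁻¹ * (designSub X γ)ᵀ

/-- The coefficient of determination
`R_γ² = 1 - ‖Q_γ(y-ȳ1)‖²/‖y-ȳ1‖²` of the submodel `γ`. -/
noncomputable def RsqC {n p : ℕ} (X : Matrix (Fin n) (Fin p) ℝ) (γ : Finset (Fin p))
    (y : Fin n → ℝ) : ℝ :=
  1 - (∑ i, ((residProj X γ).mulVec (fun j => y j - (∑ l, y l) / n) i) ^ 2)
      / (∑ i, (y i - (∑ l, y l) / n) ^ 2)

/-- The response `y = α_T 1 + X β_T + σ_T ε` of the true model. -/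
noncomputable def yResp {n p : ℕ} (X : Matrix (Fin n) (Fin p) ℝ) (αT : ℝ)
    (βT : Fin p → ℝ) (σT : ℝ) (ε : Fin n → ℝ) : Fin n → ℝ :=
  fun i => αT + X.mulVec βT i + σT * ε i

/-- The `g`-integral `I_δ(n)` appearing in the mixture-of-`g`-priors Bayes factor for a
submodel with `q` predictors and coefficient of determination `R`. -/
noncomputable def mixIntegral (n : ℕ) (k ν : ℝ) (q : ℕ) (R : ℝ) : ℝ :=
  ∫ g in Set.Ioi (0:ℝ), g ^ (ν / 2 - 1) * (1 + g⁻¹) ^ (-k / 2)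
    * (1 + g) ^ (((n : ℝ) - q - 1) / 2) * (g * (1 - R) + 1) ^ (-((n : ℝ) - 1) / 2)

theorem rpow_le_rpow_self_mul_exp {s x : ℝ} (hs : 0 ≤ s) (hx : 0 ≤ x) :
    x ^ s ≤ s ^ s * Real.exp x := by
  rcases hs.eq_or_lt with rfl | hs
  · simpa using hx
  have h : x ≤ s * Real.exp (x / s) := by
    have := Real.add_one_le_exp (x / s)
    calc x = s * (x / s) := by field_simp
      _ ≤ _ := by gcongr; linarith
  calc x ^ s ≤ (s * Real.exp (x / s)) ^ s := by gcongr
    _ = s ^ s * Real.exp x := by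
      rw [Real.mul_rpow hs.le (Real.exp_pos _).le, ← Real.exp_mul]
      congr 2; field_simp

theorem integrableOn_mixing_density {k ν b : ℝ} (hk : 0 ≤ k) (hν : -k < ν) (hb : ν / 2 < b) :
    IntegrableOn (fun g : ℝ => g ^ (ν / 2 - 1) * (1 + g⁻¹) ^ (-k / 2) * (1 + g) ^ (-b))
      (Set.Ioi 0) := by
  have hmeas : Measurable
      (fun g : ℝ => g ^ (ν / 2 - 1) * (1 + g⁻¹) ^ (-k / 2) * (1 + g) ^ (-b)) := by fun_prop
  rw [← Set.Ioc_union_Ioi_eq_Ioi zero_le_one]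
  refine IntegrableOn.union ?_ ?_
  · have h1 : IntegrableOn (fun g : ℝ => 2 ^ |b| * g ^ ((ν + k) / 2 - 1)) (Set.Ioc 0 1) := by
      refine Integrable.const_mul ?_ _
      exact (intervalIntegrable_iff_integrableOn_Ioc_of_le zero_le_one).1
        (intervalIntegral.intervalIntegrable_rpow' (by linarith))
    refine Integrable.mono' h1 hmeas.aestronglyMeasurable ?_
    refine (ae_restrict_iff' measurableSet_Ioc).2 (ae_of_all _ fun g hg => ?_)
    obtain ⟨h0, hle⟩ := hg
    rw [Real.norm_of_nonneg (by positivity)]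
    have e1 : g ^ (ν / 2 - 1) * (1 + g⁻¹) ^ (-k / 2) ≤ g ^ ((ν + k) / 2 - 1) := by
      have : (1 + g⁻¹) ^ (-k / 2) ≤ g ^ (k / 2) := by
        calc (1 + g⁻¹) ^ (-k / 2) ≤ (g⁻¹) ^ (-k / 2) :=
              Real.rpow_le_rpow_of_nonpos (by positivity) (by linarith) (by linarith)
          _ = g ^ (k / 2) := by rw [Real.inv_rpow h0.le, ← Real.rpow_neg h0.le]; congr 1; ring
      calc _ ≤ g ^ (ν / 2 - 1) * g ^ (k / 2) := by gcongr
        _ = _ := by rw [← Real.rpow_add h0]; congr 1; ring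
    have e2 : (1 + g) ^ (-b) ≤ 2 ^ |b| := by
      calc (1 + g) ^ (-b) ≤ (1 + g) ^ |b| := by
            apply Real.rpow_le_rpow_of_exponent_le (by linarith) (neg_le_abs b)
        _ ≤ 2 ^ |b| := by gcongr; linarith
    rw [mul_comm]
    gcongr
  · have h1 : IntegrableOn (fun g : ℝ => 2 ^ |b| * g ^ (ν / 2 - b - 1)) (Set.Ioi 1) := by
      refine Integrable.const_mul ?_ _
      exact integrableOn_Ioi_rpow_of_lt (by linarith) one_pos
    refine Integrable.mono' h1 hmeas.aestronglyMeasurable ?_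
    refine (ae_restrict_iff' measurableSet_Ioi).2 (ae_of_all _ fun g hg => ?_)
    have hg1 : 1 < g := hg
    have h0 : 0 < g := by linarith
    rw [Real.norm_of_nonneg (by positivity)]
    have e1 : (1 + g⁻¹) ^ (-k / 2) ≤ 1 :=
      Real.rpow_le_one_of_one_le_of_nonpos (by simp [h0.le]) (by linarith)
    have e2 : (1 + g) ^ (-b) ≤ 2 ^ |b| * g ^ (-b) := by
      have : (1 + g) = (1 + g⁻¹) * g := by field_simp; ring
      rw [this, Real.mul_rpow (by positivity) h0.le]
      gcongr
      calc (1 + g⁻¹) ^ (-b) ≤ (1 + g⁻¹) ^ |b| := by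
            apply Real.rpow_le_rpow_of_exponent_le (by simp [h0.le]) (neg_le_abs b)
        _ ≤ 2 ^ |b| := by
          have : g⁻¹ ≤ 1 := inv_le_one_of_one_le₀ hg1.le
          gcongr; linarith
    calc _ ≤ g ^ (ν / 2 - 1) * 1 * (2 ^ |b| * g ^ (-b)) := by gcongr
      _ = 2 ^ |b| * (g ^ (ν / 2 - 1) * g ^ (-b)) := by ring
      _ = _ := by rw [← Real.rpow_add h0]; congr 2; ring

/-- Shape of the likelihood factor, with `u = 1 - R²`. -/
theorem likelihood_factor_eq {g u N : ℝ} (q : ℕ) (hg : 0 < g) (hu : 0 < u) :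
    (1 + g) ^ ((N - q) / 2) * (g * u + 1) ^ (-N / 2)
      = (1 + g) ^ (-(q / 2 : ℝ)) * u ^ (-N / 2) * (u * (1 + g) / (1 + g * u)) ^ (N / 2) := by
  have h1 : 0 < 1 + g := by linarith
  have h2 : 0 < 1 + g * u := by positivity
  rw [Real.div_rpow (by positivity) h2.le, Real.mul_rpow hu.le h1.le, add_comm (g * u) 1,
    show (N - q) / 2 = -(q / 2 : ℝ) + N / 2 by ring, Real.rpow_add h1,
    show -N / 2 = -(N / 2) by ring, Real.rpow_neg h2.le, Real.rpow_neg hu.le]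
  field_simp

theorem likelihood_factor_le {g u N s : ℝ} (q : ℕ) (hg : 0 < g) (hu : 0 < u) (hu1 : u < 1)
    (hN : 0 < N) (hs : 0 ≤ s) :
    (1 + g) ^ ((N - q) / 2) * (g * u + 1) ^ (-N / 2)
      ≤ s ^ s * 2 ^ s * (u ^ (-N / 2) * (N * (1 - u)) ^ (-s)) * (1 + g) ^ (-(q / 2 - s)) := by
  have h1 : 0 < 1 + g := by linarith
  have h2 : 0 < 1 + g * u := by positivity
  have h3 : 0 < 1 - u := by linarith
  set x := N * (1 - u) / (2 * (1 + g)) with hx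
  have hx0 : 0 < x := by positivity
  have e1 : u * (1 + g) / (1 + g * u) ≤ Real.exp (-((1 - u) / (1 + g))) := by
    calc u * (1 + g) / (1 + g * u) = -((1 - u) / (1 + g * u)) + 1 := by field_simp; ring
      _ ≤ -((1 - u) / (1 + g)) + 1 := by
        gcongr; nlinarith
      _ ≤ _ := Real.add_one_le_exp _
  have e2 : (u * (1 + g) / (1 + g * u)) ^ (N / 2) ≤ Real.exp (-x) := by
    calc _ ≤ (Real.exp (-((1 - u) / (1 + g)))) ^ (N / 2) := by gcongr
      _ = _ := by rw [← Real.exp_mul]; congr 1; rw [hx]; field_simp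
  have e3 : Real.exp (-x) ≤ s ^ s * x ^ (-s) := by
    have := rpow_le_rpow_self_mul_exp hs hx0.le
    rw [Real.exp_neg, Real.rpow_neg hx0.le, ← div_eq_mul_inv, le_div_iff₀ (by positivity),
      inv_mul_le_iff₀ (Real.exp_pos _)]
    linarith
  have e4 : x ^ (-s) = (N * (1 - u)) ^ (-s) * (2 ^ s * (1 + g) ^ s) := by
    rw [hx, Real.div_rpow (by positivity) (by positivity), Real.mul_rpow (x := 2) (by norm_num) h1.le,
      Real.rpow_neg (x := 2) (by norm_num), Real.rpow_neg h1.le]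
    field_simp
  rw [likelihood_factor_eq q hg hu, show -(q / 2 - s : ℝ) = -(q / 2 : ℝ) + s by ring,
    Real.rpow_add h1]
  calc _ ≤ (1 + g) ^ (-(q / 2 : ℝ)) * u ^ (-N / 2)
        * (s ^ s * ((N * (1 - u)) ^ (-s) * (2 ^ s * (1 + g) ^ s))) := by
        gcongr; rw [← e4]; exact e2.trans e3
    _ = _ := by ring

theorem mixIntegrand_le {n q : ℕ} {k ν g u s : ℝ} (hn : 2 ≤ n) (hg : 0 < g) (hu : 0 < u)
    (hu1 : u < 1) (hs : 0 ≤ s) :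
    g ^ (ν / 2 - 1) * (1 + g⁻¹) ^ (-k / 2) * (1 + g) ^ (((n : ℝ) - q - 1) / 2)
        * (g * u + 1) ^ (-((n : ℝ) - 1) / 2)
      ≤ s ^ s * 2 ^ s * (u ^ (-((n : ℝ) - 1) / 2) * (((n : ℝ) - 1) * (1 - u)) ^ (-s))
        * (g ^ (ν / 2 - 1) * (1 + g⁻¹) ^ (-k / 2) * (1 + g) ^ (-(q / 2 - s))) := by
  have hn' : (2 : ℝ) ≤ n := by exact_mod_cast hn
  have := likelihood_factor_le (N := (n : ℝ) - 1) q hg hu hu1 (by linarith) hs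
  rw [show (n : ℝ) - q - 1 = n - 1 - q by ring, mul_assoc]
  calc _ ≤ g ^ (ν / 2 - 1) * (1 + g⁻¹) ^ (-k / 2) *
        (s ^ s * 2 ^ s * (u ^ (-((n : ℝ) - 1) / 2) * (((n : ℝ) - 1) * (1 - u)) ^ (-s)) *
          (1 + g) ^ (-(q / 2 - s))) := by gcongr
    _ = _ := by ring

theorem integrableOn_mixIntegrand {n q : ℕ} {k ν u : ℝ} (hn : 2 ≤ n) (hk : 0 ≤ k) (hν : -k < ν)
    (hq : ν < q) (hu : 0 < u) (hu1 : u < 1) :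
    IntegrableOn (fun g : ℝ => g ^ (ν / 2 - 1) * (1 + g⁻¹) ^ (-k / 2)
      * (1 + g) ^ (((n : ℝ) - q - 1) / 2) * (g * u + 1) ^ (-((n : ℝ) - 1) / 2)) (Set.Ioi 0) := by
  refine Integrable.mono' ((integrableOn_mixing_density (b := q / 2 - 0) hk hν
    (by linarith)).const_mul (0 ^ (0 : ℝ) * 2 ^ (0 : ℝ) * (u ^ (-((n : ℝ) - 1) / 2)
      * (((n : ℝ) - 1) * (1 - u)) ^ (-0 : ℝ)))) (Measurable.aestronglyMeasurable (by fun_prop)) ?_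
  refine (ae_restrict_iff' measurableSet_Ioi).2 (ae_of_all _ fun g hg => ?_)
  have hg' : 0 < g := hg
  rw [Real.norm_of_nonneg (by positivity)]
  exact mixIntegrand_le hn hg' hu hu1 le_rfl

/-- Upper bound for the `g`-integral; `s` trades decay in `n` against tail integrability. -/
theorem exists_mixIntegral_le {q : ℕ} {k ν s : ℝ} (hk : 0 ≤ k) (hν : -k < ν) (hs : 0 ≤ s)
    (hsq : s < (q - ν) / 2) :
    ∃ C : ℝ, 0 ≤ C ∧ ∀ n : ℕ, 2 ≤ n → ∀ u : ℝ, 0 < u → u < 1 →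
      mixIntegral n k ν q (1 - u)
        ≤ C * (u ^ (-((n : ℝ) - 1) / 2) * (((n : ℝ) - 1) * (1 - u)) ^ (-s)) := by
  refine ⟨s ^ s * 2 ^ s * ∫ g in Set.Ioi (0 : ℝ),
    g ^ (ν / 2 - 1) * (1 + g⁻¹) ^ (-k / 2) * (1 + g) ^ (-(q / 2 - s)), ?_, ?_⟩
  · refine mul_nonneg (by positivity) (setIntegral_nonneg measurableSet_Ioi fun g hg => ?_)
    have hg' : 0 < g := hg
    positivity
  · intro n hn u hu hu1
    unfold mixIntegral
    rw [_root_.sub_sub_cancel]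
    refine (setIntegral_mono_on (integrableOn_mixIntegrand hn hk hν (by linarith) hu hu1)
      ((integrableOn_mixing_density (b := q / 2 - s) hk hν (by linarith)).const_mul _)
      measurableSet_Ioi fun g hg => mixIntegrand_le hn hg hu hu1 hs).trans_eq ?_
    rw [integral_const_mul]
    ring

theorem exists_le_mixIntegral {q : ℕ} {k ν a : ℝ} (hk : 0 ≤ k) (hν : -k < ν) (hν1 : ν < 1)
    (hq : ν < q) (ha : 0 < a) :
    ∃ c : ℝ, 0 < c ∧ ∀ n : ℕ, 2 ≤ n → ∀ u : ℝ, a ≤ u → u < 1 →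
      c * (u ^ (-((n : ℝ) - 1) / 2) * (n : ℝ) ^ ((ν - q) / 2))
        ≤ mixIntegral n k ν q (1 - u) := by
  refine ⟨2 ^ (ν / 2 - 1) * 2 ^ (-k / 2) * 3 ^ (-(q / 2 : ℝ)) * Real.exp (-(1 / (2 * a))),
    by positivity, ?_⟩
  intro n hn u hau hu1
  have hn' : (2 : ℝ) ≤ n := by exact_mod_cast hn
  have hn0 : (0 : ℝ) < n := by linarith
  have hu : 0 < u := ha.trans_le hau
  have hint := integrableOn_mixIntegrand (q := q) hn hk hν hq hu hu1
  unfold mixIntegral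
  rw [_root_.sub_sub_cancel]
  have hsub : Set.Ioc (n : ℝ) (2 * n) ⊆ Set.Ioi 0 := fun g hg => hn0.trans hg.1
  refine le_trans ?_ (setIntegral_mono_set hint ?_ (LE.le.eventuallyLE hsub))
  swap
  · refine (ae_restrict_iff' measurableSet_Ioi).2 (ae_of_all _ fun g hg => ?_)
    have hg' : 0 < g := hg
    simp only [Pi.zero_apply]
    positivity
  set B : ℝ := (2 * n) ^ (ν / 2 - 1) * 2 ^ (-k / 2)
    * ((3 * n) ^ (-(q / 2 : ℝ)) * u ^ (-((n : ℝ) - 1) / 2) * Real.exp (-(1 / (2 * a)))) with hB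
  have hpt : ∀ g ∈ Set.Ioc (n : ℝ) (2 * n), B ≤ g ^ (ν / 2 - 1) * (1 + g⁻¹) ^ (-k / 2)
      * (1 + g) ^ (((n : ℝ) - q - 1) / 2) * (g * u + 1) ^ (-((n : ℝ) - 1) / 2) := by
    rintro g ⟨hg1, hg2⟩
    have hg : 0 < g := hn0.trans hg1
    have hg1' : (1 : ℝ) ≤ g := by linarith
    rw [show (n : ℝ) - q - 1 = n - 1 - q by ring, mul_assoc _ ((1 + g) ^ (((n : ℝ) - 1 - q) / 2)),
      likelihood_factor_eq q hg hu, hB]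
    have e1 : (2 * (n : ℝ)) ^ (ν / 2 - 1) ≤ g ^ (ν / 2 - 1) :=
      Real.rpow_le_rpow_of_nonpos hg hg2 (by linarith)
    have e2 : (2 : ℝ) ^ (-k / 2) ≤ (1 + g⁻¹) ^ (-k / 2) :=
      Real.rpow_le_rpow_of_nonpos (by positivity)
        (by linarith [inv_le_one_of_one_le₀ hg1']) (by linarith)
    have e3 : (3 * (n : ℝ)) ^ (-(q / 2 : ℝ)) ≤ (1 + g) ^ (-(q / 2 : ℝ)) :=
      Real.rpow_le_rpow_of_nonpos (by positivity) (by linarith) (by simp; positivity)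
    have e4 : Real.exp (-(1 / (2 * a))) ≤ (u * (1 + g) / (1 + g * u)) ^ (((n : ℝ) - 1) / 2) := by
      have h5 : Real.exp (-(1 / (a * n))) ≤ u * (1 + g) / (1 + g * u) := by
        have h6 : (1 + g * u) / (u * (1 + g)) ≤ Real.exp (1 / (a * n)) := by
          calc (1 + g * u) / (u * (1 + g)) = (1 - u) / (u * (1 + g)) + 1 := by field_simp; ring
            _ ≤ 1 / (a * n) + 1 := by gcongr <;> linarith
            _ ≤ _ := Real.add_one_le_exp _
        rw [Real.exp_neg, ← inv_div (1 + g * u)]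
        exact inv_anti₀ (by positivity) h6
      calc Real.exp (-(1 / (2 * a))) ≤ Real.exp (-(1 / (a * n))) ^ (((n : ℝ) - 1) / 2) := by
            rw [← Real.exp_mul]
            gcongr
            rw [neg_mul, neg_le_neg_iff, div_mul_div_comm, div_le_div_iff₀ (by positivity) (by positivity)]
            nlinarith
        _ ≤ _ := by gcongr; linarith
    gcongr
  have hconst : ∫ _ in Set.Ioc (n : ℝ) (2 * n), B = n * B := by
    simp [two_mul]
  calc _ = n * B := by
        rw [hB, Real.mul_rpow (by norm_num) hn0.le, Real.mul_rpow (by norm_num) hn0.le,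
          show (ν - q) / 2 = 1 + (ν / 2 - 1) + -(q / 2 : ℝ) by ring, Real.rpow_add hn0,
          Real.rpow_add hn0, Real.rpow_one]
        ring
    _ = ∫ _ in Set.Ioc (n : ℝ) (2 * n), B := hconst.symm
    _ ≤ _ := setIntegral_mono_on (by simp) (hint.mono_set hsub) measurableSet_Ioc hpt

theorem exists_mixIntegral_div_le {qγ qT : ℕ} {k ν a s : ℝ} (hk : 0 ≤ k) (hν : -k < ν)
    (hν1 : ν < 1) (hs : 0 ≤ s) (hsq : s < (qγ - ν) / 2) (hqT : ν < qT) (ha : 0 < a) :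
    ∃ C : ℝ, 0 ≤ C ∧ ∀ n : ℕ, 2 ≤ n → ∀ uT uγ : ℝ, a ≤ uT → uT < 1 → 0 < uγ → uγ < 1 →
      mixIntegral n k ν qγ (1 - uγ) / mixIntegral n k ν qT (1 - uT)
        ≤ C * ((uT / uγ) ^ (((n : ℝ) - 1) / 2)
          * ((((n : ℝ) - 1) * (1 - uγ)) ^ (-s) * (n : ℝ) ^ ((qT - ν) / 2))) := by
  obtain ⟨C, hC, hup⟩ := exists_mixIntegral_le (q := qγ) hk hν hs hsq
  obtain ⟨c, hc, hlo⟩ := exists_le_mixIntegral (q := qT) hk hν hν1 hqT ha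
  refine ⟨C / c, by positivity, fun n hn uT uγ hT hT1 hγ hγ1 => ?_⟩
  have hT0 : 0 < uT := ha.trans_le hT
  have hn' : (2 : ℝ) ≤ n := by exact_mod_cast hn
  have hn0 : (0 : ℝ) < n := by linarith
  have h1 : 0 < (((n : ℝ) - 1) * (1 - uγ)) := mul_pos (by linarith) (by linarith)
  refine (div_le_div₀ (by positivity) (hup n hn uγ hγ hγ1) (by positivity)
    (hlo n hn uT hT hT1)).trans_eq ?_
  rw [Real.div_rpow hT0.le hγ.le, show -((n : ℝ) - 1) / 2 = -(((n : ℝ) - 1) / 2) by ring,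
    show (ν - qT) / 2 = -((qT - ν) / 2) by ring, Real.rpow_neg hT0.le, Real.rpow_neg hγ.le,
    Real.rpow_neg hn0.le]
  field_simp

theorem eventually_mixIntegral_div_le_of_gap {qγ qT : ℕ} {k ν a ρ δ : ℝ} (hk : 0 ≤ k)
    (hν : -k < ν) (hν1 : ν < 1) (hqγ : ν < qγ) (hqT : ν < qT) (ha : 0 < a) (hρ0 : 0 < ρ)
    (hρ : ρ < 1) (hδ : 0 < δ) :
    ∀ᶠ n : ℕ in atTop, ∀ uT uγ : ℝ, a ≤ uT → uT < 1 → 0 < uγ → uγ < 1 → uT ≤ ρ * uγ →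
      mixIntegral n k ν qγ (1 - uγ) / mixIntegral n k ν qT (1 - uT) ≤ δ := by
  obtain ⟨C, hC, h⟩ := exists_mixIntegral_div_le (s := 0) hk hν hν1 le_rfl
    (show (0 : ℝ) < (qγ - ν) / 2 by linarith) hqT ha
  have hlim : Tendsto (fun x : ℝ => C * (ρ ^ (-(1 / 2 : ℝ)) *
      (x ^ (((qT : ℝ) - ν) / 2) * Real.exp (-(-Real.log ρ / 2) * x)))) atTop (nhds 0) := by
    have := tendsto_rpow_mul_exp_neg_mul_atTop_nhds_zero (((qT : ℝ) - ν) / 2) (-Real.log ρ / 2)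
      (by linarith [Real.log_neg hρ0 hρ])
    simpa using (this.const_mul _).const_mul C
  filter_upwards [eventually_ge_atTop 2,
    (hlim.comp tendsto_natCast_atTop_atTop).eventually (eventually_le_nhds hδ)]
    with n hn hb uT uγ hT hT1 hγ hγ1 hTγ
  refine (h n hn uT uγ hT hT1 hγ hγ1).trans (le_trans ?_ hb)
  have hT0 : 0 < uT := ha.trans_le hT
  have hn' : (2 : ℝ) ≤ n := by exact_mod_cast hn
  have e1 : (uT / uγ) ^ (((n : ℝ) - 1) / 2) ≤ ρ ^ (((n : ℝ) - 1) / 2) := by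
    have : uT / uγ ≤ ρ := (div_le_iff₀ hγ).2 hTγ
    have : (0 : ℝ) ≤ ((n : ℝ) - 1) / 2 := by linarith
    gcongr
  have e2 : ρ ^ (((n : ℝ) - 1) / 2)
      = ρ ^ (-(1 / 2 : ℝ)) * Real.exp (-(-Real.log ρ / 2) * n) := by
    rw [show ((n : ℝ) - 1) / 2 = -(1 / 2) + n / 2 by ring, Real.rpow_add hρ0,
      Real.rpow_def_of_pos hρ0 (n / 2)]
    congr 2; ring
  simp only [neg_zero, Real.rpow_zero, one_mul, Function.comp]
  calc _ ≤ C * (ρ ^ (((n : ℝ) - 1) / 2) * (n : ℝ) ^ ((qT - ν) / 2)) := by gcongr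
    _ = _ := by rw [e2]; ring

theorem eventually_mixIntegral_div_le_of_lt {qγ qT : ℕ} {k ν a b L δ : ℝ} (hk : 0 ≤ k)
    (hν : -k < ν) (hν1 : ν < 1) (hqT : 1 ≤ qT) (hq : qT < qγ) (ha : 0 < a)
    (hb : 0 < b) (hδ : 0 < δ) :
    ∀ᶠ n : ℕ in atTop, ∀ uT uγ : ℝ, a ≤ uT → uT < 1 → 0 < uγ → b ≤ 1 - uγ →
      uT ≤ (1 + L / (n - 1)) * uγ →
      mixIntegral n k ν qγ (1 - uγ) / mixIntegral n k ν qT (1 - uT) ≤ δ := by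
  have hqT' : (1 : ℝ) ≤ qT := by exact_mod_cast hqT
  have hq' : (qT : ℝ) + 1 ≤ qγ := by exact_mod_cast hq
  set s : ℝ := (qT - ν) / 2 + 1 / 4 with hs
  obtain ⟨C, hC, h⟩ := exists_mixIntegral_div_le (s := s) hk hν hν1 (by rw [hs]; linarith)
    (show s < (qγ - ν) / 2 by rw [hs]; linarith) (show ν < qT by linarith) ha
  have hlim : Tendsto (fun x : ℝ => C * (Real.exp (L / 2) *
      ((b / 2) ^ (-s) * x ^ (-(1 / 4 : ℝ))))) atTop (nhds 0) := by
    have := tendsto_rpow_neg_atTop (show (0 : ℝ) < 1 / 4 by norm_num)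
    simpa using ((this.const_mul _).const_mul _).const_mul C
  filter_upwards [eventually_ge_atTop 2,
    (hlim.comp tendsto_natCast_atTop_atTop).eventually (eventually_le_nhds hδ)]
    with n hn hb' uT uγ hT hT1 hγ hγ1 hTγ
  refine (h n hn uT uγ hT hT1 hγ (by linarith)).trans (le_trans ?_ hb')
  have hT0 : 0 < uT := ha.trans_le hT
  have hn' : (2 : ℝ) ≤ n := by exact_mod_cast hn
  have hn0 : (0 : ℝ) < n := by linarith
  have hn1 : (0 : ℝ) < (n : ℝ) - 1 := by linarith
  have e1 : (uT / uγ) ^ (((n : ℝ) - 1) / 2) ≤ Real.exp (L / 2) := by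
    have : uT / uγ ≤ Real.exp (L / (n - 1)) :=
      ((div_le_iff₀ hγ).2 hTγ).trans (by linarith [Real.add_one_le_exp (L / ((n : ℝ) - 1))])
    calc _ ≤ (Real.exp (L / (n - 1))) ^ (((n : ℝ) - 1) / 2) := by gcongr
      _ = _ := by rw [← Real.exp_mul]; congr 1; field_simp
  have e2 : (((n : ℝ) - 1) * (1 - uγ)) ^ (-s) ≤ (b / 2) ^ (-s) * (n : ℝ) ^ (-s) := by
    rw [← Real.mul_rpow (by positivity) hn0.le]
    refine Real.rpow_le_rpow_of_nonpos (by positivity) ?_ (by rw [hs]; linarith)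
    calc b / 2 * n = (n / 2) * b := by ring
      _ ≤ _ := by gcongr; linarith
  have h1 : 0 < (((n : ℝ) - 1) * (1 - uγ)) := mul_pos (by linarith) (by linarith)
  calc _ ≤ C * (Real.exp (L / 2) * ((b / 2) ^ (-s) * (n : ℝ) ^ (-s) * (n : ℝ) ^ ((qT - ν) / 2))) := by
        gcongr
    _ = _ := by
      rw [mul_assoc ((b / 2) ^ (-s)), ← Real.rpow_add hn0]
      simp only [Function.comp]
      congr 4
      rw [hs]; ring

section Design

variable {n p : ℕ} {X : Matrix (Fin n) (Fin p) ℝ} {δ : Finset (Fin p)}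

/-- The orthogonal projector onto the column space of the submodel `δ`. -/
noncomputable def hatMatrix (X : Matrix (Fin n) (Fin p) ℝ) (δ : Finset (Fin p)) :
    Matrix (Fin n) (Fin n) ℝ :=
  designSub X δ * ((designSub X δ)ᵀ * designSub X δ)⁻¹ * (designSub X δ)ᵀ

theorem hatMatrix_transpose : (hatMatrix X δ)ᵀ = hatMatrix X δ := by
  simp [hatMatrix, Matrix.transpose_nonsing_inv, Matrix.mul_assoc]

theorem transpose_designSub_mul_hatMatrix
    (h : IsUnit ((designSub X δ)ᵀ * designSub X δ).det) :
    (designSub X δ)ᵀ * hatMatrix X δ = (designSub X δ)ᵀ := by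
  rw [hatMatrix, ← Matrix.mul_assoc, ← Matrix.mul_assoc, Matrix.mul_nonsing_inv _ h,
    Matrix.one_mul]

theorem hatMatrix_mul_designSub (h : IsUnit ((designSub X δ)ᵀ * designSub X δ).det) :
    hatMatrix X δ * designSub X δ = designSub X δ := by
  rw [hatMatrix, Matrix.mul_assoc, Matrix.mul_assoc, Matrix.nonsing_inv_mul _ h, Matrix.mul_one]

theorem hatMatrix_mul_self (h : IsUnit ((designSub X δ)ᵀ * designSub X δ).det) :
    hatMatrix X δ * hatMatrix X δ = hatMatrix X δ := by
  conv_lhs => enter [2]; rw [hatMatrix]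
  rw [← Matrix.mul_assoc, ← Matrix.mul_assoc, hatMatrix_mul_designSub h, hatMatrix]

theorem trace_hatMatrix_mul_transpose (h : IsUnit ((designSub X δ)ᵀ * designSub X δ).det) :
    (hatMatrix X δ * (hatMatrix X δ)ᵀ).trace = δ.card := by
  rw [hatMatrix_transpose, hatMatrix_mul_self h, hatMatrix, Matrix.mul_assoc,
    Matrix.trace_mul_comm, Matrix.mul_assoc, Matrix.nonsing_inv_mul _ h]
  simp

theorem designSub_mulVec (b : {j // j ∈ δ} → ℝ) :
    designSub X δ *ᵥ b = X *ᵥ (fun j => if h : j ∈ δ then b ⟨j, h⟩ else 0) := by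
  ext i
  simp only [Matrix.mulVec, dotProduct, designSub, Matrix.of_apply]
  set f : Fin p → ℝ := fun j => X i j * (if h : j ∈ δ then b ⟨j, h⟩ else 0) with hf
  have h1 : ∑ j, f j = ∑ j ∈ δ, f j :=
    (Finset.sum_subset (Finset.subset_univ δ) fun j _ hj => by simp [hf, hj]).symm
  rw [h1, ← Finset.sum_coe_sort δ f]
  refine Finset.sum_congr rfl fun j _ => ?_
  simp [hf]

theorem hatMatrix_mulVec_mulVec (h : IsUnit ((designSub X δ)ᵀ * designSub X δ).det)
    {β : Fin p → ℝ} (hβ : ∀ j ∉ δ, β j = 0) :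
    hatMatrix X δ *ᵥ (X *ᵥ β) = X *ᵥ β := by
  have : X *ᵥ β = designSub X δ *ᵥ (fun j => β j) := by
    rw [designSub_mulVec]
    congr 1; ext j
    by_cases hj : j ∈ δ <;> simp [hj, hβ]
  rw [this, Matrix.mulVec_mulVec, hatMatrix_mul_designSub h]

theorem mulVec_dotProduct_of_transpose_eq {ι : Type*} [Fintype ι] {B : Matrix ι ι ℝ}
    (hB : Bᵀ = B) (v w : ι → ℝ) : (B *ᵥ v) ⬝ᵥ w = v ⬝ᵥ (B *ᵥ w) := by
  rw [Matrix.dotProduct_mulVec, ← Matrix.mulVec_transpose, hB]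

theorem hatMatrix_mulVec_dotProduct_self (h : IsUnit ((designSub X δ)ᵀ * designSub X δ).det)
    (v : Fin n → ℝ) :
    (hatMatrix X δ *ᵥ v) ⬝ᵥ (hatMatrix X δ *ᵥ v) = v ⬝ᵥ (hatMatrix X δ *ᵥ v) := by
  rw [mulVec_dotProduct_of_transpose_eq hatMatrix_transpose, Matrix.mulVec_mulVec,
    hatMatrix_mul_self h]

theorem hatMatrix_mulVec_one (horth : ∀ j, ∑ i, X i j = 0) : hatMatrix X δ *ᵥ 1 = 0 := by
  have : (designSub X δ)ᵀ *ᵥ 1 = 0 := by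
    ext j; simpa [Matrix.mulVec, dotProduct, designSub] using horth j
  rw [hatMatrix, ← Matrix.mulVec_mulVec, this, Matrix.mulVec_zero]

theorem residProj_mulVec (v : Fin n → ℝ) : residProj X δ *ᵥ v = v - hatMatrix X δ *ᵥ v := by
  rw [residProj, Matrix.sub_mulVec, Matrix.one_mulVec, hatMatrix]

theorem residProj_mulVec_dotProduct_self (h : IsUnit ((designSub X δ)ᵀ * designSub X δ).det)
    (v : Fin n → ℝ) :
    (residProj X δ *ᵥ v) ⬝ᵥ (residProj X δ *ᵥ v)
      = v ⬝ᵥ v - (hatMatrix X δ *ᵥ v) ⬝ᵥ (hatMatrix X δ *ᵥ v) := by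
  rw [residProj_mulVec, sub_dotProduct, dotProduct_sub, dotProduct_sub,
    hatMatrix_mulVec_dotProduct_self h, dotProduct_comm (hatMatrix X δ *ᵥ v) v]
  ring

theorem residProj_mulVec_dotProduct_lt (h : IsUnit ((designSub X δ)ᵀ * designSub X δ).det)
    {v : Fin n → ℝ} {j : Fin p} (hj : j ∈ δ) (hv : (fun i => X i j) ⬝ᵥ v ≠ 0) :
    (residProj X δ *ᵥ v) ⬝ᵥ (residProj X δ *ᵥ v) < v ⬝ᵥ v := by
  have h0 : hatMatrix X δ *ᵥ v ≠ 0 := by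
    intro h0
    apply hv
    have h1 : (designSub X δ)ᵀ *ᵥ v = 0 := by
      rw [← transpose_designSub_mul_hatMatrix h, ← Matrix.mulVec_mulVec, h0, Matrix.mulVec_zero]
    exact congrFun h1 ⟨j, hj⟩
  have h2 : 0 ≤ (hatMatrix X δ *ᵥ v) ⬝ᵥ (hatMatrix X δ *ᵥ v) :=
    Finset.sum_nonneg fun i _ => mul_self_nonneg _
  have h3 : (hatMatrix X δ *ᵥ v) ⬝ᵥ (hatMatrix X δ *ᵥ v) ≠ 0 := by
    simpa [dotProduct_self_eq_zero] using h0
  rw [residProj_mulVec_dotProduct_self h]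
  linarith [lt_of_le_of_ne h2 h3.symm]

/-- The residual sum of squares of a mean vector `m` plus noise centred at its sample mean. -/
theorem residProj_mulVec_signal_add_noise (horth : ∀ j, ∑ i, X i j = 0)
    (h : IsUnit ((designSub X δ)ᵀ * designSub X δ).det) (hn : n ≠ 0)
    {m : Fin n → ℝ} (hm : 1 ⬝ᵥ m = 0) (σ : ℝ) (e : Fin n → ℝ) :
    (residProj X δ *ᵥ (m + σ • (e - ((1 ⬝ᵥ e) / n) • 1)))
        ⬝ᵥ (residProj X δ *ᵥ (m + σ • (e - ((1 ⬝ᵥ e) / n) • 1)))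
      = (residProj X δ *ᵥ m) ⬝ᵥ (residProj X δ *ᵥ m) + 2 * σ * ((residProj X δ *ᵥ m) ⬝ᵥ e)
        + σ ^ 2 * (e ⬝ᵥ e - (1 ⬝ᵥ e) ^ 2 / n - (hatMatrix X δ *ᵥ e) ⬝ᵥ (hatMatrix X δ *ᵥ e)) := by
  have h1 : hatMatrix X δ *ᵥ 1 = 0 := hatMatrix_mulVec_one horth
  have hone : (1 : Fin n → ℝ) ⬝ᵥ 1 = n := by simp [dotProduct]
  have hP1 : ∀ v : Fin n → ℝ, (hatMatrix X δ *ᵥ v) ⬝ᵥ 1 = 0 := fun v => by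
    rw [mulVec_dotProduct_of_transpose_eq hatMatrix_transpose, h1, dotProduct_zero]
  have hn' : (n : ℝ) ≠ 0 := by exact_mod_cast hn
  rw [residProj_mulVec_dotProduct_self h, residProj_mulVec_dotProduct_self h, residProj_mulVec]
  simp only [Matrix.mulVec_add, Matrix.mulVec_sub, Matrix.mulVec_smul, h1, smul_zero, sub_zero,
    add_dotProduct, dotProduct_add, sub_dotProduct, dotProduct_sub, smul_dotProduct,
    dotProduct_smul, smul_eq_mul, hone, dotProduct_comm m 1, hm, dotProduct_comm e 1,
    dotProduct_comm e m, dotProduct_comm (hatMatrix X δ *ᵥ e) (hatMatrix X δ *ᵥ m)]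
  have h2 : (hatMatrix X δ *ᵥ m) ⬝ᵥ (hatMatrix X δ *ᵥ e) = (hatMatrix X δ *ᵥ m) ⬝ᵥ e := by
    rw [← mulVec_dotProduct_of_transpose_eq hatMatrix_transpose, Matrix.mulVec_mulVec,
      hatMatrix_mul_self h]
  rw [h2]
  field_simp
  ring

theorem signal_add_noise_dotProduct_self (hn : n ≠ 0)
    {m : Fin n → ℝ} (hm : 1 ⬝ᵥ m = 0) (σ : ℝ) (e : Fin n → ℝ) :
    (m + σ • (e - ((1 ⬝ᵥ e) / n) • 1)) ⬝ᵥ (m + σ • (e - ((1 ⬝ᵥ e) / n) • 1))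
      = m ⬝ᵥ m + 2 * σ * (m ⬝ᵥ e) + σ ^ 2 * (e ⬝ᵥ e - (1 ⬝ᵥ e) ^ 2 / n) := by
  have hone : (1 : Fin n → ℝ) ⬝ᵥ 1 = n := by simp [dotProduct]
  have hn' : (n : ℝ) ≠ 0 := by exact_mod_cast hn
  simp only [add_dotProduct, dotProduct_add, sub_dotProduct, dotProduct_sub, smul_dotProduct,
    dotProduct_smul, smul_eq_mul, hone, dotProduct_comm m 1, hm, dotProduct_comm e 1,
    dotProduct_comm e m]
  field_simp
  ring

theorem one_dotProduct_mulVec (horth : ∀ j, ∑ i, X i j = 0) (β : Fin p → ℝ) :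
    1 ⬝ᵥ (X *ᵥ β) = 0 := by
  rw [Matrix.dotProduct_mulVec]
  have : (1 : Fin n → ℝ) ᵥ* X = 0 := by
    ext j; simpa [Matrix.vecMul, dotProduct] using horth j
  rw [this, zero_dotProduct]

theorem yResp_sub_mean (horth : ∀ j, ∑ i, X i j = 0) (hn : n ≠ 0) (α σ : ℝ) (β : Fin p → ℝ)
    (e : Fin n → ℝ) :
    (fun i => yResp X α β σ e i - (∑ l, yResp X α β σ e l) / n)
      = X *ᵥ β + σ • (e - ((1 ⬝ᵥ e) / n) • 1) := by
  have hn' : (n : ℝ) ≠ 0 := by exact_mod_cast hn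
  have hm := one_dotProduct_mulVec horth β
  have hsum : ∑ l, yResp X α β σ e l = n * α + σ * (1 ⬝ᵥ e) := by
    simp only [yResp, Finset.sum_add_distrib, ← Finset.mul_sum]
    simp only [dotProduct, Pi.one_apply, one_mul] at hm ⊢
    rw [hm]; simp
  ext i
  rw [hsum]
  simp only [yResp, Pi.add_apply, Pi.smul_apply, Pi.sub_apply, smul_eq_mul, Pi.one_apply]
  field_simp
  ring

theorem RsqC_yResp (horth : ∀ j, ∑ i, X i j = 0) (hn : n ≠ 0) (α σ : ℝ) (β : Fin p → ℝ)
    (e : Fin n → ℝ) :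
    RsqC X δ (yResp X α β σ e)
      = 1 - (residProj X δ *ᵥ (X *ᵥ β + σ • (e - ((1 ⬝ᵥ e) / n) • 1)))
          ⬝ᵥ (residProj X δ *ᵥ (X *ᵥ β + σ • (e - ((1 ⬝ᵥ e) / n) • 1)))
        / ((X *ᵥ β + σ • (e - ((1 ⬝ᵥ e) / n) • 1))
          ⬝ᵥ (X *ᵥ β + σ • (e - ((1 ⬝ᵥ e) / n) • 1))) := by
  have h := yResp_sub_mean horth hn α σ β e
  unfold RsqC
  rw [h]
  have h2 : ∀ i, yResp X α β σ e i - (∑ l, yResp X α β σ e l) / n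
    = (X *ᵥ β + σ • (e - ((1 ⬝ᵥ e) / n) • 1)) i := fun i => congrFun h i
  simp only [h2, dotProduct, sq]

theorem isUnit_gram_of_lower_bound {c : ℝ} (hc : 0 < c)
    (hX : ∀ v : Fin p → ℝ, c * ‖v‖ ^ 2 ≤ (X *ᵥ v) ⬝ᵥ (X *ᵥ v)) (δ : Finset (Fin p)) :
    IsUnit ((designSub X δ)ᵀ * designSub X δ).det := by
  rw [isUnit_iff_ne_zero]
  intro h0
  obtain ⟨b, hb, hb0⟩ := Matrix.exists_mulVec_eq_zero_iff.2 h0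
  apply hb
  have h1 : (designSub X δ *ᵥ b) ⬝ᵥ (designSub X δ *ᵥ b) = 0 := by
    rw [Matrix.dotProduct_mulVec, ← Matrix.mulVec_transpose, Matrix.mulVec_mulVec, hb0,
      zero_dotProduct]
  rw [designSub_mulVec] at h1
  have h2 := hX (fun j => if h : j ∈ δ then b ⟨j, h⟩ else 0)
  rw [h1] at h2
  have h3 : ‖(fun j => if h : j ∈ δ then b ⟨j, h⟩ else 0)‖ = 0 := by
    by_contra hne
    have : 0 < ‖(fun j => if h : j ∈ δ then b ⟨j, h⟩ else 0)‖ := lt_of_le_of_ne (norm_nonneg _) (Ne.symm hne)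
    have := mul_pos hc (pow_pos this 2)
    linarith
  ext ⟨j, hj⟩
  have := congrFun (norm_eq_zero.1 h3) j
  simpa [hj] using this

/-- Omitting an active predictor leaves a residual signal of linear order. -/
theorem le_residProj_mulVec_dotProduct {c : ℝ} (hc : 0 < c)
    (hX : ∀ v : Fin p → ℝ, c * ‖v‖ ^ 2 ≤ (X *ᵥ v) ⬝ᵥ (X *ᵥ v)) (β : Fin p → ℝ)
    {j : Fin p} (hj : j ∉ δ) :
    c * β j ^ 2 ≤ (residProj X δ *ᵥ (X *ᵥ β)) ⬝ᵥ (residProj X δ *ᵥ (X *ᵥ β)) := by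
  set b := ((designSub X δ)ᵀ * designSub X δ)⁻¹ *ᵥ ((designSub X δ)ᵀ *ᵥ (X *ᵥ β)) with hb
  set v : Fin p → ℝ := β - (fun j => if h : j ∈ δ then b ⟨j, h⟩ else 0) with hv
  have h1 : residProj X δ *ᵥ (X *ᵥ β) = X *ᵥ v := by
    rw [residProj_mulVec, hv, Matrix.mulVec_sub, ← designSub_mulVec, hb, hatMatrix]
    simp only [Matrix.mulVec_mulVec, Matrix.mul_assoc]
  rw [h1]
  refine le_trans ?_ (hX v)
  have h2 : |β j| ≤ ‖v‖ := by
    have := norm_le_pi_norm v j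
    simpa [hv, hj] using this
  have h3 : β j ^ 2 ≤ ‖v‖ ^ 2 := sq_le_sq' (by linarith [abs_le.1 h2]) (abs_le.1 h2).2
  gcongr

end Design

theorem abs_dotProduct_mulVec_le {p : ℕ} (S : Matrix (Fin p) (Fin p) ℝ) (v : Fin p → ℝ) :
    |v ⬝ᵥ (S *ᵥ v)| ≤ (∑ i, ∑ j, |S i j|) * ‖v‖ ^ 2 := by
  simp only [dotProduct, Matrix.mulVec, Finset.mul_sum, Finset.sum_mul]
  refine (Finset.abs_sum_le_sum_abs _ _).trans (Finset.sum_le_sum fun i _ => ?_)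
  refine (Finset.abs_sum_le_sum_abs _ _).trans (Finset.sum_le_sum fun j _ => ?_)
  rw [abs_mul, abs_mul]
  have hi : |v i| ≤ ‖v‖ := norm_le_pi_norm v i
  have hj : |v j| ≤ ‖v‖ := norm_le_pi_norm v j
  calc |v i| * (|S i j| * |v j|) ≤ ‖v‖ * (|S i j| * ‖v‖) := by gcongr
    _ = _ := by ring

theorem Matrix.PosDef.exists_pos_le_dotProduct {p : ℕ} {S : Matrix (Fin p) (Fin p) ℝ}
    (hS : S.PosDef) : ∃ c : ℝ, 0 < c ∧ ∀ v : Fin p → ℝ, c * ‖v‖ ^ 2 ≤ v ⬝ᵥ (S *ᵥ v) := by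
  have hcont : Continuous fun v : Fin p → ℝ => v ⬝ᵥ (S *ᵥ v) := by
    simp only [dotProduct, Matrix.mulVec]; fun_prop
  obtain ⟨c, hc, h⟩ := (isCompact_sphere (0 : Fin p → ℝ) 1).exists_forall_le' (a := 0)
    hcont.continuousOn (fun v hv => by
      have hv0 : v ≠ 0 := by
        rintro rfl; simp at hv
      simpa using hS.dotProduct_mulVec_pos hv0)
  refine ⟨c, hc, fun v => ?_⟩
  rcases eq_or_ne v 0 with rfl | hv
  · simp
  have hv' : 0 < ‖v‖ := norm_pos_iff.2 hv
  have := h (‖v‖⁻¹ • v) (by simp [norm_smul, hv'.ne'])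
  rw [Matrix.mulVec_smul, smul_dotProduct, dotProduct_smul, smul_eq_mul, smul_eq_mul] at this
  calc c * ‖v‖ ^ 2 ≤ (‖v‖⁻¹ * (‖v‖⁻¹ * (v ⬝ᵥ (S *ᵥ v)))) * ‖v‖ ^ 2 := by gcongr
    _ = _ := by field_simp

theorem eventually_design_bounds {p : ℕ} {X : (n : ℕ) → Matrix (Fin n) (Fin p) ℝ}
    (hA2 : ∃ S₀ : Matrix (Fin p) (Fin p) ℝ, S₀.PosDef ∧
      Tendsto (fun n : ℕ => ((n : ℝ)⁻¹) • ((X n)ᵀ * X n)) atTop (nhds S₀)) :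
    ∃ c C : ℝ, 0 < c ∧ 0 < C ∧ ∀ᶠ n : ℕ in atTop, ∀ v : Fin p → ℝ,
      c * n * ‖v‖ ^ 2 ≤ (X n *ᵥ v) ⬝ᵥ (X n *ᵥ v) ∧
      (X n *ᵥ v) ⬝ᵥ (X n *ᵥ v) ≤ C * n * ‖v‖ ^ 2 := by
  obtain ⟨S, hS, hlim⟩ := hA2
  obtain ⟨c, hc, hcS⟩ := hS.exists_pos_le_dotProduct
  have hD : Tendsto (fun n : ℕ => ∑ i, ∑ j, |(((n : ℝ)⁻¹) • ((X n)ᵀ * X n) - S) i j|) atTop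
      (nhds 0) := by
    have h1 : Continuous fun B : Matrix (Fin p) (Fin p) ℝ => ∑ i, ∑ j, |(B - S) i j| := by
      simp only [Matrix.sub_apply]; fun_prop
    simpa [Function.comp_def] using (h1.tendsto S).comp hlim
  refine ⟨c / 2, (∑ i, ∑ j, |S i j|) + c / 2, by positivity, by positivity, ?_⟩
  filter_upwards [hD.eventually (eventually_le_nhds (half_pos hc)), eventually_gt_atTop 0]
    with n hn hn0 v
  have hn' : (0 : ℝ) < n := by exact_mod_cast hn0
  have e : (X n *ᵥ v) ⬝ᵥ (X n *ᵥ v)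
      = n * (v ⬝ᵥ (S *ᵥ v) + v ⬝ᵥ ((((n : ℝ)⁻¹) • ((X n)ᵀ * X n) - S) *ᵥ v)) := by
    rw [Matrix.sub_mulVec, dotProduct_sub, Matrix.smul_mulVec, dotProduct_smul, smul_eq_mul,
      ← Matrix.mulVec_mulVec, Matrix.dotProduct_mulVec v (X n)ᵀ, Matrix.vecMul_transpose]
    field_simp
    ring
  have b1 := abs_le.1 ((abs_dotProduct_mulVec_le ((((n : ℝ)⁻¹) • ((X n)ᵀ * X n) - S)) v).trans
    (mul_le_mul_of_nonneg_right hn (by positivity)))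
  have b2 := (abs_le.1 (abs_dotProduct_mulVec_le S v)).2
  have b3 := hcS v
  rw [e]
  constructor
  · calc c / 2 * n * ‖v‖ ^ 2 = n * (c * ‖v‖ ^ 2 + -(c / 2 * ‖v‖ ^ 2)) := by ring
      _ ≤ _ := by gcongr; exact b1.1
  · calc _ ≤ n * ((∑ i, ∑ j, |S i j|) * ‖v‖ ^ 2 + c / 2 * ‖v‖ ^ 2) := by gcongr; exact b1.2
      _ = _ := by ring

section Noise

variable {Ω : Type*} [MeasurableSpace Ω] {P : Measure Ω} {n : ℕ} {e : Ω → Fin n → ℝ}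

theorem integrable_mul_of_cov [IsProbabilityMeasure P] (he : Measurable e)
    (hcov : ∀ i j, ∫ ω, e ω i * e ω j ∂P = if i = j then 1 else 0) (i j : Fin n) :
    Integrable (fun ω => e ω i * e ω j) P := by
  have hm : ∀ i, Measurable fun ω => e ω i := fun i => (measurable_pi_apply i).comp he
  have hsq : ∀ i, Integrable (fun ω => e ω i * e ω i) P := fun i => by
    by_contra h
    have := hcov i i
    rw [integral_undef h] at this
    simp at this
  refine ((hsq i).add (hsq j)).mono' ((hm i).mul (hm j)).aestronglyMeasurable
    (ae_of_all _ fun ω => ?_)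
  simp only [Pi.add_apply, Real.norm_eq_abs]
  rw [abs_le]
  constructor <;> nlinarith [sq_nonneg (e ω i + e ω j), sq_nonneg (e ω i - e ω j)]

theorem dotProduct_sq_eq_sum {ι : Type*} [Fintype ι] (v x : ι → ℝ) :
    (v ⬝ᵥ x) ^ 2 = ∑ i, ∑ j, v i * v j * (x i * x j) := by
  rw [sq, dotProduct, Finset.sum_mul_sum]
  exact Finset.sum_congr rfl fun i _ => Finset.sum_congr rfl fun j _ => by ring

theorem integrable_dotProduct_sq [IsProbabilityMeasure P] (he : Measurable e)
    (hcov : ∀ i j, ∫ ω, e ω i * e ω j ∂P = if i = j then 1 else 0) (v : Fin n → ℝ) :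
    Integrable (fun ω => (v ⬝ᵥ e ω) ^ 2) P := by
  simp only [dotProduct_sq_eq_sum]
  exact integrable_finsetSum _ fun i _ => integrable_finsetSum _ fun j _ =>
    (integrable_mul_of_cov he hcov i j).const_mul _

theorem integral_dotProduct_sq [IsProbabilityMeasure P] (he : Measurable e)
    (hcov : ∀ i j, ∫ ω, e ω i * e ω j ∂P = if i = j then 1 else 0) (v : Fin n → ℝ) :
    ∫ ω, (v ⬝ᵥ e ω) ^ 2 ∂P = v ⬝ᵥ v := by
  have hi := integrable_mul_of_cov he hcov
  simp only [dotProduct_sq_eq_sum]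
  rw [integral_finsetSum _ fun i _ => integrable_finsetSum _ fun j _ => (hi i j).const_mul _]
  refine Finset.sum_congr rfl fun i _ => ?_
  rw [integral_finsetSum _ fun j _ => (hi i j).const_mul _]
  simp [integral_const_mul, hcov]

theorem measure_ge_le_ofReal_div [IsProbabilityMeasure P] {f : Ω → ℝ} (hf0 : ∀ ω, 0 ≤ f ω)
    (hf : Integrable f P) {t I : ℝ} (ht : 0 < t) (hI : ∫ ω, f ω ∂P ≤ I) :
    P {ω | t ≤ f ω} ≤ ENNReal.ofReal (I / t) := by
  have h := mul_meas_ge_le_integral_of_nonneg (ae_of_all P hf0) hf t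
  rw [← ofReal_measureReal]
  exact ENNReal.ofReal_le_ofReal ((le_div_iff₀ ht).2 (by linarith))

theorem measure_dotProduct_sq_ge_le [IsProbabilityMeasure P] (he : Measurable e)
    (hcov : ∀ i j, ∫ ω, e ω i * e ω j ∂P = if i = j then 1 else 0) (v : Fin n → ℝ)
    {t : ℝ} (ht : 0 < t) :
    P {ω | t ≤ (v ⬝ᵥ e ω) ^ 2} ≤ ENNReal.ofReal (v ⬝ᵥ v / t) :=
  measure_ge_le_ofReal_div (fun _ => sq_nonneg _) (integrable_dotProduct_sq he hcov v) ht
    (integral_dotProduct_sq he hcov v).le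

theorem measure_mulVec_dotProduct_ge_le [IsProbabilityMeasure P] (he : Measurable e)
    (hcov : ∀ i j, ∫ ω, e ω i * e ω j ∂P = if i = j then 1 else 0)
    (B : Matrix (Fin n) (Fin n) ℝ) {t : ℝ} (ht : 0 < t) :
    P {ω | t ≤ (B *ᵥ e ω) ⬝ᵥ (B *ᵥ e ω)} ≤ ENNReal.ofReal ((B * Bᵀ).trace / t) := by
  have h : ∀ ω, (B *ᵥ e ω) ⬝ᵥ (B *ᵥ e ω) = ∑ i, (B i ⬝ᵥ e ω) ^ 2 := fun ω =>
    Finset.sum_congr rfl fun i _ => (sq _).symm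
  simp only [h]
  refine measure_ge_le_ofReal_div (fun _ => Finset.sum_nonneg fun _ _ => sq_nonneg _)
    (integrable_finsetSum _ fun i _ => integrable_dotProduct_sq he hcov (B i)) ht ?_
  rw [integral_finsetSum _ fun i _ => integrable_dotProduct_sq he hcov (B i)]
  simp only [integral_dotProduct_sq he hcov]
  rfl

theorem exists_orthogonal_mulVec_eq {u v : Fin n → ℝ} (h : u ⬝ᵥ u = v ⬝ᵥ v) :
    ∃ O : Matrix (Fin n) (Fin n) ℝ, Oᵀ * O = 1 ∧ Oᵀ *ᵥ u = v := by
  rcases eq_or_ne u v with rfl | huv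
  · exact ⟨1, by simp, by simp⟩
  set w := u - v with hw
  have hd : w ⬝ᵥ w ≠ 0 := by
    rw [Ne, dotProduct_self_eq_zero]; exact sub_ne_zero.2 huv
  set O : Matrix (Fin n) (Fin n) ℝ := 1 - (2 / (w ⬝ᵥ w)) • vecMulVec w w with hO
  have hsymm : Oᵀ = O := by
    rw [hO]; simp [transpose_vecMulVec]
  refine ⟨O, ?_, ?_⟩
  · have h1 : vecMulVec w w * vecMulVec w w = (w ⬝ᵥ w) • vecMulVec w w := by
      rw [vecMulVec_mul_vecMulVec, vecMulVec_smul]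
    rw [hsymm, hO, sub_mul, mul_sub, mul_sub]
    simp only [Matrix.smul_mul, Matrix.mul_smul, h1, smul_smul]
    have h2 : 2 / (w ⬝ᵥ w) * (2 / (w ⬝ᵥ w) * (w ⬝ᵥ w)) = 2 / (w ⬝ᵥ w) + 2 / (w ⬝ᵥ w) := by
      field_simp; ring
    rw [h2, add_smul]
    simp
  · rw [hsymm, hO, Matrix.sub_mulVec, Matrix.one_mulVec, Matrix.smul_mulVec, vecMulVec_mulVec,
      op_smul_eq_smul, smul_smul]
    have h3 : 2 / (w ⬝ᵥ w) * (w ⬝ᵥ u) = 1 := by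
      rw [div_mul_eq_mul_div, div_eq_one_iff_eq hd]
      simp only [hw, sub_dotProduct, dotProduct_sub, dotProduct_comm v u, h]
      ring
    rw [h3, hw]; simp

theorem measure_dotProduct_eq_congr (he : Measurable e)
    (hsph : ∀ O : Matrix (Fin n) (Fin n) ℝ, Oᵀ * O = 1 →
      P.map (fun ω => O.mulVec (e ω)) = P.map e)
    {u v : Fin n → ℝ} (h : u ⬝ᵥ u = v ⬝ᵥ v) (c : ℝ) :
    P {ω | u ⬝ᵥ e ω = c} = P {ω | v ⬝ᵥ e ω = c} := by
  obtain ⟨O, hO, hOu⟩ := exists_orthogonal_mulVec_eq h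
  have hms : ∀ u : Fin n → ℝ, Measurable fun x : Fin n → ℝ => u ⬝ᵥ x := fun u => by
    simp only [dotProduct]; fun_prop
  have hs : MeasurableSet {x : Fin n → ℝ | u ⬝ᵥ x = c} := hms u (measurableSet_singleton c)
  have hOe : Measurable fun ω => O.mulVec (e ω) :=
    (Continuous.matrix_mulVec continuous_const continuous_id).measurable.comp he
  calc P {ω | u ⬝ᵥ e ω = c} = P.map e {x | u ⬝ᵥ x = c} := (Measure.map_apply he hs).symm
    _ = P {ω | u ⬝ᵥ O.mulVec (e ω) = c} := by rw [← hsph O hO, Measure.map_apply hOe hs]; rfl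
    _ = _ := by
      simp only [Matrix.dotProduct_mulVec, ← Matrix.mulVec_transpose, hOu]

theorem measure_dotProduct_eq_le_pair [IsProbabilityMeasure P] (he : Measurable e)
    (hsph : ∀ O : Matrix (Fin n) (Fin n) ℝ, Oᵀ * O = 1 →
      P.map (fun ω => O.mulVec (e ω)) = P.map e)
    {u : Fin n → ℝ} (hu : u ≠ 0) (c : ℝ) {a b : Fin n} (hab : a ≠ b) :
    P {ω | u ⬝ᵥ e ω = c} ≤ P {ω | e ω a = 0 ∧ e ω b = 0} := by
  have hm : ∀ i, Measurable fun ω => e ω i := fun i => (measurable_pi_apply i).comp he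
  have huu : 0 < u ⬝ᵥ u := lt_of_le_of_ne (Finset.sum_nonneg fun _ _ => mul_self_nonneg _)
    (Ne.symm (by rwa [Ne, dotProduct_self_eq_zero]))
  set r := √(u ⬝ᵥ u) with hr
  have hr0 : 0 < r := Real.sqrt_pos.2 huu
  set g : ℝ → Ω → ℝ := fun s ω => ((c / r) * e ω a + s * (e ω b
    * √(e ω a ^ 2 + e ω b ^ 2 - (c / r) ^ 2))) / (e ω a ^ 2 + e ω b ^ 2) with hg
  have hgm : ∀ s, Measurable (g s) := fun s => by
    have := hm a
    have := hm b
    simp only [hg]; fun_prop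
  have hcount : ({t | 0 < P {ω | g 1 ω = t}} ∪ {t | 0 < P {ω | g (-1) ω = t}}).Countable :=
    (Measure.countable_meas_level_set_pos (hgm 1)).union
      (Measure.countable_meas_level_set_pos (hgm (-1)))
  obtain ⟨t, ⟨ht0, ht1⟩, ht⟩ : ∃ t ∈ Set.Ioo (0 : ℝ) 1,
      t ∉ {t | 0 < P {ω | g 1 ω = t}} ∪ {t | 0 < P {ω | g (-1) ω = t}} := by
    by_contra! hcon
    have := (hcount.mono hcon).measure_zero volume
    simp at this
  simp only [Set.mem_union, Set.mem_ofPred_eq, not_or, not_lt, nonpos_iff_eq_zero] at ht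
  set y := √(1 - t ^ 2) with hy
  have hty : t ^ 2 + y ^ 2 = 1 := by
    rw [hy, Real.sq_sqrt (by nlinarith)]; ring
  have hv : u ⬝ᵥ u = (Pi.single a (r * t) + Pi.single b (r * y) : Fin n → ℝ)
      ⬝ᵥ (Pi.single a (r * t) + Pi.single b (r * y)) := by
    have : r ^ 2 = u ⬝ᵥ u := Real.sq_sqrt huu.le
    simp [hab, hab.symm]
    rw [← this]
    linear_combination -(r ^ 2) * hty
  rw [measure_dotProduct_eq_congr he hsph hv c]
  have hsub : {ω | (Pi.single a (r * t) + Pi.single b (r * y) : Fin n → ℝ) ⬝ᵥ e ω = c}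
      ⊆ ({ω | g 1 ω = t} ∪ {ω | g (-1) ω = t}) ∪ {ω | e ω a = 0 ∧ e ω b = 0} := by
    intro ω hω
    have hω' : r * (t * e ω a + y * e ω b) = c := by
      simp only [Set.mem_ofPred_eq, add_dotProduct, single_dotProduct] at hω
      linarith
    have hc : c / r = t * e ω a + y * e ω b := by
      rw [← hω']; field_simp
    by_cases hz : e ω a = 0 ∧ e ω b = 0
    · exact Or.inr hz
    refine Or.inl ?_
    have hpos : e ω a ^ 2 + e ω b ^ 2 ≠ 0 := by
      intro h0
      exact hz ⟨by nlinarith [sq_nonneg (e ω a), sq_nonneg (e ω b)],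
        by nlinarith [sq_nonneg (e ω a), sq_nonneg (e ω b)]⟩
    have hs : √(e ω a ^ 2 + e ω b ^ 2 - (c / r) ^ 2) = |e ω b * t - e ω a * y| := by
      rw [← Real.sqrt_sq_eq_abs]
      congr 1
      rw [hc]
      linear_combination (-(e ω a ^ 2 + e ω b ^ 2)) * hty
    rw [hc] at hs
    simp only [hg, Set.mem_union, Set.mem_ofPred_eq, hc, hs, div_eq_iff hpos]
    rcases abs_choice (e ω b * t - e ω a * y) with h | h <;> rw [h]
    · left; ring
    · right; ring
  calc _ ≤ P (({ω | g 1 ω = t} ∪ {ω | g (-1) ω = t}) ∪ {ω | e ω a = 0 ∧ e ω b = 0}) :=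
        measure_mono hsub
    _ ≤ (P {ω | g 1 ω = t} + P {ω | g (-1) ω = t}) + P {ω | e ω a = 0 ∧ e ω b = 0} :=
        (measure_union_le _ _).trans (by gcongr; exact measure_union_le _ _)
    _ = _ := by rw [ht.1, ht.2]; simp

/-- A spherically symmetric vector charges an affine hyperplane at most through the origin. -/
theorem measure_dotProduct_eq_le_measure_eq_zero [IsProbabilityMeasure P] (he : Measurable e)
    (hsph : ∀ O : Matrix (Fin n) (Fin n) ℝ, Oᵀ * O = 1 →
      P.map (fun ω => O.mulVec (e ω)) = P.map e)
    (hn : 2 ≤ n) {u : Fin n → ℝ} (hu : u ≠ 0) (c : ℝ) :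
    P {ω | u ⬝ᵥ e ω = c} ≤ P {ω | e ω = 0} := by
  have hm : ∀ i, Measurable fun ω => e ω i := fun i => (measurable_pi_apply i).comp he
  have hz : ∀ i, MeasurableSet {ω | e ω i = 0} := fun i => hm i (measurableSet_singleton 0)
  set a : Fin n := ⟨0, by omega⟩
  set b : Fin n := ⟨1, by omega⟩
  have hab : a ≠ b := by simp [a, b]
  refine (measure_dotProduct_eq_le_pair he hsph hu c hab).trans ?_
  refine (measure_mono (fun ω h => h.1 : _ ⊆ {ω | e ω a = 0})).trans ?_
  have hnull : ∀ i, P ({ω | e ω a = 0} \ {ω | e ω i = 0}) = 0 := by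
    intro i
    rcases eq_or_ne a i with rfl | hi
    · simp
    have h1 := measure_dotProduct_eq_le_pair he hsph (u := Pi.single a 1) (by simp) 0 hi
    simp only [single_dotProduct, one_mul] at h1
    have h2 := measure_sdiff_add_inter (μ := P) {ω | e ω a = 0} (hz i)
    have h3 : {ω | e ω a = 0} ∩ {ω | e ω i = 0} = {ω | e ω a = 0 ∧ e ω i = 0} := rfl
    rw [h3] at h2
    have hfin : P {ω | e ω a = 0 ∧ e ω i = 0} ≠ ⊤ := measure_ne_top _ _
    rw [← h2] at h1
    simpa using ENNReal.le_of_add_le_add_right hfin (h1.trans_eq (zero_add _).symm)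
  have hsub : {ω | e ω a = 0} ⊆ {ω | e ω = 0} ∪ ⋃ i, ({ω | e ω a = 0} \ {ω | e ω i = 0}) := by
    intro ω hω
    by_cases h : e ω = 0
    · exact Or.inl h
    · obtain ⟨i, hi⟩ := Function.ne_iff.1 h
      exact Or.inr (Set.mem_iUnion.2 ⟨i, hω, hi⟩)
  refine (measure_mono hsub).trans ((measure_union_le _ _).trans_eq ?_)
  rw [measure_iUnion_null hnull, add_zero]

end Noise

section Probability

variable {Ω : Type*} [MeasurableSpace Ω] {P : Measure Ω}

theorem measure_not_and_le {A B : Ω → Prop} {a b : ℝ} (ha : 0 ≤ a) (hb : 0 ≤ b)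
    (hA : P {ω | ¬ A ω} ≤ ENNReal.ofReal a) (hB : P {ω | ¬ B ω} ≤ ENNReal.ofReal b) :
    P {ω | ¬ (A ω ∧ B ω)} ≤ ENNReal.ofReal (a + b) := by
  have : {ω | ¬ (A ω ∧ B ω)} = {ω | ¬ A ω} ∪ {ω | ¬ B ω} := by
    ext ω; simp only [Set.mem_ofPred_eq, Set.mem_union]; tauto
  rw [this, ENNReal.ofReal_add ha hb]
  exact (measure_union_le _ _).trans (add_le_add hA hB)

theorem tendsto_measure_one_of_measure_compl_le [IsProbabilityMeasure P] {E : ℕ → Set Ω}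
    (h : ∀ η : ℝ, 0 < η → ∀ᶠ n in atTop, P (E n)ᶜ ≤ ENNReal.ofReal η) :
    Tendsto (fun n => P (E n)) atTop (nhds 1) := by
  refine tendsto_order.2 ⟨fun a ha => ?_, fun a ha => Eventually.of_forall fun n =>
    prob_le_one.trans_lt ha⟩
  obtain ⟨b, hb0, hb⟩ := ENNReal.lt_iff_exists_real_btwn.1 (tsub_pos_of_lt ha)
  have hb' : 0 < b := ENNReal.ofReal_pos.1 hb.1
  filter_upwards [h b hb'] with n hn
  by_contra! hcon
  have h1 : (1 : ℝ≥0∞) ≤ P (E n) + P (E n)ᶜ := by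
    rw [← measure_univ (μ := P), ← Set.union_compl_self (E n)]
    exact measure_union_le _ _
  have h2 : (1 : ℝ≥0∞) - a ≤ ENNReal.ofReal b := by
    rw [tsub_le_iff_left]
    exact h1.trans (add_le_add hcon hn)
  exact absurd hb.2 (not_lt.2 h2)

variable {n : ℕ} {e : Ω → Fin n → ℝ}

theorem measure_not_norm_bounds_le [IsProbabilityMeasure P] (he : Measurable e) {M η : ℝ}
    (h : ENNReal.ofReal (1 - η) <
        P {ω | M⁻¹ < (∑ i, e ω i ^ 2) / n ∧ (∑ i, e ω i ^ 2) / n < M}) :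
    P {ω | ¬ (M⁻¹ < (∑ i, e ω i ^ 2) / n ∧ (∑ i, e ω i ^ 2) / n < M)} ≤ ENNReal.ofReal η := by
  have hm : Measurable fun ω => (∑ i, e ω i ^ 2) / (n : ℝ) := by
    have : ∀ i, Measurable fun ω => e ω i := fun i => (measurable_pi_apply i).comp he
    fun_prop
  have hs : MeasurableSet {ω | M⁻¹ < (∑ i, e ω i ^ 2) / n ∧ (∑ i, e ω i ^ 2) / n < M} :=
    (measurableSet_lt measurable_const hm).inter (measurableSet_lt hm measurable_const)
  have hc := prob_compl_eq_one_sub (μ := P) hs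
  have : {ω | ¬ (M⁻¹ < (∑ i, e ω i ^ 2) / n ∧ (∑ i, e ω i ^ 2) / n < M)}
    = {ω | M⁻¹ < (∑ i, e ω i ^ 2) / n ∧ (∑ i, e ω i ^ 2) / n < M}ᶜ := rfl
  rw [this, hc, tsub_le_iff_left]
  calc (1 : ℝ≥0∞) = ENNReal.ofReal ((1 - η) + η) := by simp
    _ ≤ ENNReal.ofReal (1 - η) + ENNReal.ofReal η := ENNReal.ofReal_add_le
    _ ≤ _ := by gcongr

theorem measure_eq_zero_eq_zero
    (hA1 : ∀ c : ℝ, 0 < c → ∃ M : ℝ, 1 < M ∧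
      P {ω | ¬ (M⁻¹ < (∑ i, e ω i ^ 2) / n ∧ (∑ i, e ω i ^ 2) / n < M)} ≤ ENNReal.ofReal c) :
    P {ω | e ω = 0} = 0 := by
  refine le_antisymm (ENNReal.le_of_forall_pos_le_add fun c hc _ => ?_) zero_le
  obtain ⟨M, hM, h⟩ := hA1 c hc
  rw [zero_add]
  refine (measure_mono fun ω hω => ?_).trans (h.trans_eq (ENNReal.ofReal_coe_nnreal))
  have h0 : e ω = 0 := hω
  rintro ⟨h1, -⟩
  rw [h0] at h1
  have : 0 < M⁻¹ := inv_pos.2 (by linarith)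
  simp at h1
  linarith

theorem measure_not_noise_bounds_le [IsProbabilityMeasure P] (he : Measurable e)
    (hsph : ∀ O : Matrix (Fin n) (Fin n) ℝ, Oᵀ * O = 1 →
      P.map (fun ω => O.mulVec (e ω)) = P.map e)
    (hcov : ∀ i j, ∫ ω, e ω i * e ω j ∂P = if i = j then 1 else 0) (hn : 2 ≤ n)
    {p : ℕ} {X : Matrix (Fin n) (Fin p) ℝ}
    (hgram : ∀ δ : Finset (Fin p), IsUnit ((designSub X δ)ᵀ * designSub X δ).det)
    (T γ : Finset (Fin p)) {m d u : Fin n → ℝ} (hu : u ≠ 0) (r : ℝ) {η M K : ℝ} (hη : 0 < η)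
    (hK : 0 < K)
    (hM : P {ω | ¬ (M⁻¹ < (∑ i, e ω i ^ 2) / n ∧ (∑ i, e ω i ^ 2) / n < M)} ≤ ENNReal.ofReal η)
    (hz : P {ω | e ω = 0} = 0) (hp : p ≤ η * K) (h1 : 1 ≤ η * K)
    (hm : m ⬝ᵥ m ≤ η * (K * n)) (hd : d ⬝ᵥ d ≤ η * (K * n)) :
    P {ω | ¬ ((M⁻¹ < (∑ i, e ω i ^ 2) / n ∧ (∑ i, e ω i ^ 2) / n < M) ∧
      (hatMatrix X T *ᵥ e ω) ⬝ᵥ (hatMatrix X T *ᵥ e ω) < K ∧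
      (hatMatrix X γ *ᵥ e ω) ⬝ᵥ (hatMatrix X γ *ᵥ e ω) < K ∧
      (1 ⬝ᵥ e ω) ^ 2 < K * n ∧ (m ⬝ᵥ e ω) ^ 2 < K * n ∧ (d ⬝ᵥ e ω) ^ 2 < K * n ∧
      u ⬝ᵥ e ω ≠ r)} ≤ ENNReal.ofReal (6 * η) := by
  have hn0 : (0 : ℝ) < n := by exact_mod_cast (by omega : 0 < n)
  have hKn : 0 < K * n := by positivity
  have hhat : ∀ δ : Finset (Fin p),
      P {ω | ¬ ((hatMatrix X δ *ᵥ e ω) ⬝ᵥ (hatMatrix X δ *ᵥ e ω) < K)} ≤ ENNReal.ofReal η := by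
    intro δ
    simp only [not_lt]
    refine (measure_mulVec_dotProduct_ge_le he hcov _ hK).trans (ENNReal.ofReal_le_ofReal ?_)
    rw [trace_hatMatrix_mul_transpose (hgram δ), div_le_iff₀ hK]
    refine le_trans ?_ hp
    exact_mod_cast (Finset.card_le_univ δ).trans_eq (Fintype.card_fin p)
  have hvec : ∀ v : Fin n → ℝ, v ⬝ᵥ v ≤ η * (K * n) →
      P {ω | ¬ ((v ⬝ᵥ e ω) ^ 2 < K * n)} ≤ ENNReal.ofReal η := by
    intro v hv
    simp only [not_lt]
    refine (measure_dotProduct_sq_ge_le he hcov v hKn).trans (ENNReal.ofReal_le_ofReal ?_)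
    rwa [div_le_iff₀ hKn]
  have hone : (1 : Fin n → ℝ) ⬝ᵥ 1 ≤ η * (K * n) := by
    have : (1 : Fin n → ℝ) ⬝ᵥ 1 = n := by simp [dotProduct]
    rw [this, ← mul_assoc]
    nlinarith
  have hnull : P {ω | ¬ (u ⬝ᵥ e ω ≠ r)} ≤ ENNReal.ofReal 0 := by
    simp only [not_not]
    simpa [hz] using measure_dotProduct_eq_le_measure_eq_zero he hsph hn hu r
  have key := measure_not_and_le hη.le (by positivity) hM
    (measure_not_and_le hη.le (by positivity) (hhat T)
    (measure_not_and_le hη.le (by positivity) (hhat γ)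
    (measure_not_and_le hη.le (by positivity) (hvec 1 hone)
    (measure_not_and_le hη.le (by positivity) (hvec m hm)
    (measure_not_and_le hη.le le_rfl (hvec d hd) hnull)))))
  refine key.trans_eq ?_
  congr 1; ring

end Probability

/-- Sum-of-squares bounds for a model containing the truth. -/
theorem nested_model_bounds {n c C M K σ E a q μ mm : ℝ} (hc : 0 < c) (hC : 0 ≤ C) (hM : 1 < M)
    (hσ : 0 < σ) (hn : 0 < n) (hE1 : M⁻¹ < E / n) (hE2 : E / n < M) (ha0 : 0 ≤ a) (ha : a < K)
    (hq0 : 0 ≤ q) (hq : q < K) (hm1 : c * n ≤ mm) (hm2 : mm ≤ C * n)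
    (hμ : |μ| ≤ c / (4 * σ) * n) (hnK : 4 * K * M ≤ n) :
    0 < mm + 2 * σ * μ + σ ^ 2 * (E - a) ∧
    σ ^ 2 / (2 * M) * n ≤ σ ^ 2 * (E - a - q) ∧
    σ ^ 2 / (2 * M) / (C + c + σ ^ 2 * M)
      ≤ σ ^ 2 * (E - a - q) / (mm + 2 * σ * μ + σ ^ 2 * (E - a)) ∧
    c / 2 / (C + c + σ ^ 2 * M)
      ≤ 1 - σ ^ 2 * (E - a - q) / (mm + 2 * σ * μ + σ ^ 2 * (E - a)) := by
  have hM0 : 0 < M := by linarith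
  rw [lt_div_iff₀ hn] at hE1
  rw [div_lt_iff₀ hn] at hE2
  have hμ' : |2 * σ * μ| ≤ c / 2 * n := by
    rw [abs_mul, abs_of_pos (by positivity : 0 < 2 * σ)]
    calc 2 * σ * |μ| ≤ 2 * σ * (c / (4 * σ) * n) := by gcongr
      _ = _ := by field_simp; norm_num
  obtain ⟨hμ1, hμ2⟩ := abs_le.1 hμ'
  have hKn : K ≤ n / (4 * M) := by
    rw [le_div_iff₀ (by positivity)]; linarith
  have hEaq : n / (2 * M) ≤ E - a - q := by
    have : M⁻¹ * n - 2 * (n / (4 * M)) = n / (2 * M) := by field_simp; norm_num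
    linarith
  have hrss : σ ^ 2 / (2 * M) * n ≤ σ ^ 2 * (E - a - q) := by
    calc _ = σ ^ 2 * (n / (2 * M)) := by ring
      _ ≤ _ := by gcongr
  have hrss0 : 0 < σ ^ 2 / (2 * M) * n := by positivity
  have hcn : 0 < c * n := by positivity
  have hσq : 0 ≤ σ ^ 2 * q := by positivity
  have htss : mm + 2 * σ * μ + σ ^ 2 * (E - a) ≤ (C + c + σ ^ 2 * M) * n := by
    have : σ ^ 2 * (E - a) ≤ σ ^ 2 * (M * n) := by gcongr; linarith
    linarith
  have hdiff : c / 2 * n ≤ mm + 2 * σ * μ + σ ^ 2 * (E - a) - σ ^ 2 * (E - a - q) := by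
    linarith
  have htss0 : 0 < mm + 2 * σ * μ + σ ^ 2 * (E - a) := by linarith
  have hD : 0 < C + c + σ ^ 2 * M := by positivity
  refine ⟨htss0, hrss, ?_, ?_⟩
  · calc _ = σ ^ 2 / (2 * M) * n / ((C + c + σ ^ 2 * M) * n) := by field_simp
      _ ≤ _ := by gcongr; linarith
  · rw [one_sub_div htss0.ne']
    calc _ = c / 2 * n / ((C + c + σ ^ 2 * M) * n) := by field_simp
      _ ≤ _ := by gcongr; linarith

theorem abs_le_mul_of_sq_lt {x K θ n : ℝ} (hθ : 0 ≤ θ) (hn : 0 < n) (h : x ^ 2 < K * n)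
    (hK : K ≤ θ ^ 2 * n) : |x| ≤ θ * n := by
  refine abs_le_of_sq_le_sq ?_ (by positivity)
  calc x ^ 2 ≤ K * n := h.le
    _ ≤ θ ^ 2 * n * n := by gcongr
    _ = _ := by ring

/-- Residual sum-of-squares gap for a model omitting an active predictor. -/
theorem underfitted_model_gap {n c M K σ E a q qT κ dd : ℝ} (hc : 0 < c) (hM : 1 < M)
    (hσ : 0 < σ) (hn : 0 < n) (hE2 : E / n < M) (ha0 : 0 ≤ a) (hqT0 : 0 ≤ qT)
    (hq : q < K) (hd : c * n ≤ dd) (hκ : |κ| ≤ c / (8 * σ) * n) (hnK : σ ^ 2 * K ≤ c / 4 * n) :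
    σ ^ 2 * (E - a - qT)
      ≤ (1 + c / (2 * σ ^ 2 * M))⁻¹ * (dd + 2 * σ * κ + σ ^ 2 * (E - a - q)) := by
  have hM0 : 0 < M := by linarith
  rw [div_lt_iff₀ hn] at hE2
  have hκ' : |2 * σ * κ| ≤ c / 4 * n := by
    rw [abs_mul, abs_of_pos (by positivity : 0 < 2 * σ)]
    calc 2 * σ * |κ| ≤ 2 * σ * (c / (8 * σ) * n) := by gcongr
      _ = _ := by field_simp; norm_num
  have h1 := (abs_le.1 hκ').1
  have h2 : σ ^ 2 * q ≤ σ ^ 2 * K := by gcongr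
  have h3 : 0 ≤ σ ^ 2 * qT := by positivity
  have h4 : σ ^ 2 * (E - a - qT) ≤ σ ^ 2 * (M * n) := by gcongr; linarith
  rw [← div_eq_inv_mul, le_div_iff₀ (by positivity)]
  have h5 : σ ^ 2 * (E - a - qT) * (c / (2 * σ ^ 2 * M)) ≤ c / 2 * n := by
    calc _ ≤ σ ^ 2 * (M * n) * (c / (2 * σ ^ 2 * M)) := by gcongr
      _ = _ := by field_simp
  linarith

section Consistency

variable {p : ℕ} {X : (n : ℕ) → Matrix (Fin n) (Fin p) ℝ} {T γ : Finset (Fin p)}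
  {β : Fin p → ℝ} {σ c C M K k ν δ' : ℝ}

/-- A model containing the true one leaves no residual signal. -/
theorem residProj_mulVec_signal_add_noise_of_subset {n : ℕ} {X : Matrix (Fin n) (Fin p) ℝ}
    {δ : Finset (Fin p)} (horth : ∀ j, ∑ i, X i j = 0)
    (h : IsUnit ((designSub X δ)ᵀ * designSub X δ).det) (hn : n ≠ 0)
    (hβ : ∀ j ∉ δ, β j = 0) (σ : ℝ) (e : Fin n → ℝ) :
    (residProj X δ *ᵥ (X *ᵥ β + σ • (e - ((1 ⬝ᵥ e) / n) • 1)))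
        ⬝ᵥ (residProj X δ *ᵥ (X *ᵥ β + σ • (e - ((1 ⬝ᵥ e) / n) • 1)))
      = σ ^ 2 * (e ⬝ᵥ e - (1 ⬝ᵥ e) ^ 2 / n - (hatMatrix X δ *ᵥ e) ⬝ᵥ (hatMatrix X δ *ᵥ e)) := by
  rw [residProj_mulVec_signal_add_noise horth h hn (one_dotProduct_mulVec horth β),
    residProj_mulVec (X *ᵥ β), hatMatrix_mulVec_mulVec h hβ]
  simp

/-- On the noise event, the Bayes factor ratio is eventually small. -/
theorem eventually_ratio_le_of_noise_bounds (horth : ∀ n j, ∑ i, X n i j = 0) (hc : 0 < c)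
    (hC : 0 < C)
    (hX : ∀ᶠ n : ℕ in atTop, ∀ v : Fin p → ℝ, c * n * ‖v‖ ^ 2 ≤ (X n *ᵥ v) ⬝ᵥ (X n *ᵥ v) ∧
      (X n *ᵥ v) ⬝ᵥ (X n *ᵥ v) ≤ C * n * ‖v‖ ^ 2)
    (hσ : 0 < σ) (hβT : ∀ j ∈ T, β j ≠ 0) (hβT' : ∀ j ∉ T, β j = 0) (hT : T.Nonempty)
    (hγT : γ ≠ T) {j₁ : Fin p} (hj₁ : j₁ ∈ γ) (hk : 0 ≤ k) (hν₁ : -k < ν) (hν₂ : ν < 1)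
    (hM : 1 < M) (hδ' : 0 < δ') (α : ℝ) :
    ∀ᶠ n : ℕ in atTop, ∀ e : Fin n → ℝ,
      (M⁻¹ < (∑ i, e i ^ 2) / n ∧ (∑ i, e i ^ 2) / n < M) ∧
      (hatMatrix (X n) T *ᵥ e) ⬝ᵥ (hatMatrix (X n) T *ᵥ e) < K ∧
      (hatMatrix (X n) γ *ᵥ e) ⬝ᵥ (hatMatrix (X n) γ *ᵥ e) < K ∧
      (1 ⬝ᵥ e) ^ 2 < K * n ∧ ((X n *ᵥ β) ⬝ᵥ e) ^ 2 < K * n ∧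
      ((residProj (X n) γ *ᵥ (X n *ᵥ β)) ⬝ᵥ e) ^ 2 < K * n ∧
      (fun i => X n i j₁) ⬝ᵥ e ≠ -((fun i => X n i j₁) ⬝ᵥ (X n *ᵥ β)) / σ →
      0 < RsqC (X n) γ (yResp (X n) α β σ e) ∧ RsqC (X n) γ (yResp (X n) α β σ e) < 1 ∧
      0 < RsqC (X n) T (yResp (X n) α β σ e) ∧ RsqC (X n) T (yResp (X n) α β σ e) < 1 ∧
      mixIntegral n k ν γ.card (RsqC (X n) γ (yResp (X n) α β σ e)) /
        mixIntegral n k ν T.card (RsqC (X n) T (yResp (X n) α β σ e)) ≤ δ' := by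
  obtain ⟨j₀, hj₀⟩ := hT
  have hβ0 : 0 < ‖β‖ ^ 2 := by
    have : β ≠ 0 := fun h => hβT j₀ hj₀ (congrFun h j₀)
    positivity
  have hM0 : 0 < M := by linarith
  set cβ := c * ‖β‖ ^ 2 with hcβ
  set Cβ := C * ‖β‖ ^ 2 with hCβ
  have hcβ0 : 0 < cβ := by positivity
  have hCβ0 : 0 < Cβ := by positivity
  set a₀ := σ ^ 2 / (2 * M) / (Cβ + cβ + σ ^ 2 * M) with ha₀
  have ha₀0 : 0 < a₀ := by positivity
  have hcardT : 1 ≤ T.card := Finset.card_pos.2 ⟨j₀, hj₀⟩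
  have hcardγ : 1 ≤ γ.card := Finset.card_pos.2 ⟨j₁, hj₁⟩
  have hlarge : ∀ θ : ℝ, 0 < θ → ∀ x : ℝ, ∀ᶠ n : ℕ in atTop, x ≤ θ * n := fun θ hθ x =>
    (tendsto_natCast_atTop_atTop.const_mul_atTop hθ).eventually_ge_atTop x
  have hsq : ∀ n (e : Fin n → ℝ), e ⬝ᵥ e = ∑ i, e i ^ 2 := fun n e =>
    Finset.sum_congr rfl fun i _ => (sq _).symm
  have hnn : ∀ n (v : Fin n → ℝ), 0 ≤ v ⬝ᵥ v := fun n v =>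
    Finset.sum_nonneg fun i _ => mul_self_nonneg _
  by_cases hsub : T ⊆ γ
  · have hlt : T.card < γ.card :=
      Finset.card_lt_card (Finset.ssubset_iff_subset_ne.2 ⟨hsub, hγT.symm⟩)
    filter_upwards [hX, eventually_ge_atTop 2, hlarge 1 one_pos (4 * K * M),
      hlarge ((cβ / (4 * σ)) ^ 2) (by positivity) K,
      eventually_mixIntegral_div_le_of_lt (a := a₀) (b := cβ / 2 / (Cβ + cβ + σ ^ 2 * M))
        (L := σ ^ 2 * K / (σ ^ 2 / (2 * M))) hk hν₁ hν₂ hcardT hlt ha₀0 (by positivity) hδ']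
      with n hXn hn2 hn4 hnK hratio
    rintro e ⟨⟨hE1, hE2⟩, hqT, hqγ, h1e, hme, -, -⟩
    have hn0 : n ≠ 0 := by omega
    have hn : (0 : ℝ) < n := by positivity
    have hgram := isUnit_gram_of_lower_bound (c := c * n) (by positivity) fun v => (hXn v).1
    have hm := one_dotProduct_mulVec (horth n) β
    have ha : (1 ⬝ᵥ e) ^ 2 / (n : ℝ) < K := by rwa [div_lt_iff₀ hn]
    have hμ := abs_le_mul_of_sq_lt (by positivity) hn hme hnK
    have hK0 : 0 ≤ K := (hnn _ _).trans hqT.le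
    rw [one_mul] at hn4
    rw [← hsq] at hE1 hE2
    have hmm1 : cβ * n ≤ (X n *ᵥ β) ⬝ᵥ (X n *ᵥ β) := by
      convert (hXn β).1 using 1; rw [hcβ]; ring
    have hmm2 : (X n *ᵥ β) ⬝ᵥ (X n *ᵥ β) ≤ Cβ * n := by
      convert (hXn β).2 using 1; rw [hCβ]; ring
    obtain ⟨htss, hT1, hT2, hT3⟩ := nested_model_bounds hcβ0 hCβ0.le hM hσ hn hE1 hE2
      (div_nonneg (sq_nonneg _) hn.le) ha (hnn _ _) hqT hmm1 hmm2 hμ hn4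
    obtain ⟨-, hγ1, hγ2, hγ3⟩ := nested_model_bounds hcβ0 hCβ0.le hM hσ hn hE1 hE2
      (div_nonneg (sq_nonneg _) hn.le) ha (hnn _ _) hqγ hmm1 hmm2 hμ hn4
    rw [RsqC_yResp (horth n) hn0, RsqC_yResp (horth n) hn0,
      residProj_mulVec_signal_add_noise_of_subset (horth n) (hgram T) hn0 hβT',
      residProj_mulVec_signal_add_noise_of_subset (horth n) (hgram γ) hn0
        (fun j hj => hβT' j fun h => hj (hsub h)),
      signal_add_noise_dotProduct_self hn0 hm]
    set tss := (X n *ᵥ β) ⬝ᵥ (X n *ᵥ β) + 2 * σ * ((X n *ᵥ β) ⬝ᵥ e)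
      + σ ^ 2 * (e ⬝ᵥ e - (1 ⬝ᵥ e) ^ 2 / n) with htss'
    have hb : 0 < cβ / 2 / (Cβ + cβ + σ ^ 2 * M) := by positivity
    refine ⟨by linarith, by linarith, by linarith, by linarith,
      hratio _ _ hT2 (by linarith) (by linarith) hγ3 ?_⟩
    rw [← mul_div_assoc]
    refine div_le_div_of_nonneg_right ?_ htss.le
    have hn1 : (0 : ℝ) < n - 1 := by
      have : (2 : ℝ) ≤ n := by exact_mod_cast hn2
      linarith
    set rγ := σ ^ 2 * (e ⬝ᵥ e - (1 ⬝ᵥ e) ^ 2 / n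
      - (hatMatrix (X n) γ *ᵥ e) ⬝ᵥ (hatMatrix (X n) γ *ᵥ e)) with hrγ
    have hle : σ ^ 2 * K ≤ σ ^ 2 * K / (σ ^ 2 / (2 * M)) / (n - 1) * rγ := by
      calc σ ^ 2 * K = σ ^ 2 * K / (σ ^ 2 / (2 * M)) / (n - 1)
            * (σ ^ 2 / (2 * M) * (n - 1)) := by field_simp
        _ ≤ σ ^ 2 * K / (σ ^ 2 / (2 * M)) / (n - 1) * (σ ^ 2 / (2 * M) * n) := by
          gcongr; linarith
        _ ≤ _ := by gcongr
    have h2 : σ ^ 2 * ((hatMatrix (X n) γ *ᵥ e) ⬝ᵥ (hatMatrix (X n) γ *ᵥ e)) ≤ σ ^ 2 * K := by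
      gcongr
    have h3 : 0 ≤ σ ^ 2 * ((hatMatrix (X n) T *ᵥ e) ⬝ᵥ (hatMatrix (X n) T *ᵥ e)) :=
      mul_nonneg (sq_nonneg _) (hnn _ _)
    linarith
  · obtain ⟨j, hjT, hjγ⟩ := Finset.not_subset.1 hsub
    have hβj : β j ≠ 0 := hβT j hjT
    set cj := c * β j ^ 2 with hcj
    have hcj0 : 0 < cj := by positivity
    have hρ : (1 + cj / (2 * σ ^ 2 * M))⁻¹ < 1 := by
      refine inv_lt_one_of_one_lt₀ ?_
      have : 0 < cj / (2 * σ ^ 2 * M) := by positivity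
      linarith
    filter_upwards [hX, eventually_ge_atTop 2, hlarge 1 one_pos (4 * K * M),
      hlarge ((cβ / (4 * σ)) ^ 2) (by positivity) K,
      hlarge ((cj / (8 * σ)) ^ 2) (by positivity) K, hlarge (cj / 4) (by positivity) (σ ^ 2 * K),
      eventually_mixIntegral_div_le_of_gap (a := a₀) hk hν₁ hν₂
        (hν₂.trans_le (by exact_mod_cast hcardγ)) (hν₂.trans_le (by exact_mod_cast hcardT))
        ha₀0 (by positivity) hρ hδ']
      with n hXn hn2 hn4 hnK hnKj hnKσ hratio
    rintro e ⟨⟨hE1, hE2⟩, hqT, hqγ, h1e, hme, hde, hu⟩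
    have hn0 : n ≠ 0 := by omega
    have hn : (0 : ℝ) < n := by positivity
    have hgram := isUnit_gram_of_lower_bound (c := c * n) (by positivity) fun v => (hXn v).1
    have hm := one_dotProduct_mulVec (horth n) β
    have ha : (1 ⬝ᵥ e) ^ 2 / (n : ℝ) < K := by rwa [div_lt_iff₀ hn]
    have hμ := abs_le_mul_of_sq_lt (by positivity) hn hme hnK
    have hκ := abs_le_mul_of_sq_lt (by positivity) hn hde hnKj
    rw [one_mul] at hn4
    rw [← hsq] at hE1 hE2
    have hmm1 : cβ * n ≤ (X n *ᵥ β) ⬝ᵥ (X n *ᵥ β) := by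
      convert (hXn β).1 using 1; rw [hcβ]; ring
    have hmm2 : (X n *ᵥ β) ⬝ᵥ (X n *ᵥ β) ≤ Cβ * n := by
      convert (hXn β).2 using 1; rw [hCβ]; ring
    obtain ⟨htss, hT1, hT2, hT3⟩ := nested_model_bounds hcβ0 hCβ0.le hM hσ hn hE1 hE2
      (div_nonneg (sq_nonneg _) hn.le) ha (hnn _ _) hqT hmm1 hmm2 hμ hn4
    have hdd : cj * n ≤ (residProj (X n) γ *ᵥ (X n *ᵥ β)) ⬝ᵥ (residProj (X n) γ *ᵥ (X n *ᵥ β)) := by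
      convert le_residProj_mulVec_dotProduct (c := c * n) (by positivity) (fun v => (hXn v).1) β hjγ
        using 1
      rw [hcj]; ring
    have hgap := underfitted_model_gap hcj0 hM hσ hn hE2
      (div_nonneg (sq_nonneg (1 ⬝ᵥ e)) hn.le) (hnn _ (hatMatrix (X n) T *ᵥ e)) hqγ hdd hκ hnKσ
    have hlt := residProj_mulVec_dotProduct_lt (hgram γ) hj₁
      (v := X n *ᵥ β + σ • (e - ((1 ⬝ᵥ e) / n) • 1)) (by
        have hone : (fun i => X n i j₁) ⬝ᵥ (1 : Fin n → ℝ) = 0 := by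
          simpa [dotProduct] using horth n j₁
        rw [dotProduct_add, dotProduct_smul, dotProduct_sub, dotProduct_smul, hone]
        intro h0
        apply hu
        rw [eq_div_iff hσ.ne']
        simp only [smul_eq_mul, mul_zero, sub_zero] at h0
        linarith)
    rw [residProj_mulVec_signal_add_noise (horth n) (hgram γ) hn0 hm,
      signal_add_noise_dotProduct_self hn0 hm] at hlt
    rw [RsqC_yResp (horth n) hn0, RsqC_yResp (horth n) hn0,
      residProj_mulVec_signal_add_noise_of_subset (horth n) (hgram T) hn0 hβT',
      residProj_mulVec_signal_add_noise (horth n) (hgram γ) hn0 hm,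
      signal_add_noise_dotProduct_self hn0 hm]
    set tss := (X n *ᵥ β) ⬝ᵥ (X n *ᵥ β) + 2 * σ * ((X n *ᵥ β) ⬝ᵥ e)
      + σ ^ 2 * (e ⬝ᵥ e - (1 ⬝ᵥ e) ^ 2 / n) with htss'
    have hb : 0 < cβ / 2 / (Cβ + cβ + σ ^ 2 * M) := by positivity
    have hle := div_le_div_of_nonneg_right hgap htss.le
    rw [mul_div_assoc (1 + cj / (2 * σ ^ 2 * M))⁻¹] at hle
    have hγ1 := (div_lt_one htss).2 hlt
    have hγ0 := pos_of_mul_pos_right (ha₀0.trans_le (hT2.trans hle)) (by positivity)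
    exact ⟨by linarith, by linarith, by linarith, by linarith,
      hratio _ _ hT2 (by linarith) hγ0 hγ1 hle⟩

end Consistency

/-- **Corollary, consistency of the mixture-of-`g`-priors Bayes factors
under spherically symmetric errors.** For nonempty `T ≠ γ`, `k ≥ 0` and `-k < ν < 1`,
the Bayes factor ratio `I_γ(n)/I_T(n)` tends to `0` in probability. -/
theorem mixture_g_prior_consistency
    (p : ℕ) (hp : 1 ≤ p)
    (Ω : Type) [MeasurableSpace Ω] (P : Measure Ω) [IsProbabilityMeasure P]
    (X : (n : ℕ) → Matrix (Fin n) (Fin p) ℝ)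
    (ε : (n : ℕ) → Ω → Fin n → ℝ)
    (horth : ∀ n j, ∑ i, X n i j = 0)
    (hA2 : ∃ S₀ : Matrix (Fin p) (Fin p) ℝ, S₀.PosDef ∧
      Tendsto (fun n : ℕ => ((n : ℝ)⁻¹) • ((X n)ᵀ * X n)) atTop (nhds S₀))
    (hmeas : ∀ n, Measurable (ε n))
    (hsph : ∀ (n : ℕ) (O : Matrix (Fin n) (Fin n) ℝ), Oᵀ * O = 1 →
      P.map (fun ω => O.mulVec (ε n ω)) = P.map (ε n))
    (hmean : ∀ n i, ∫ ω, ε n ω i ∂P = 0)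
    (hcov : ∀ n i j, ∫ ω, ε n ω i * ε n ω j ∂P = if i = j then 1 else 0)
    (hA1 : ∀ c : ℝ, 0 < c → ∃ M : ℝ, 1 < M ∧ ∀ n : ℕ, 0 < n →
      ENNReal.ofReal (1 - c) <
        P {ω | M⁻¹ < (∑ i, ε n ω i ^ 2) / n ∧ (∑ i, ε n ω i ^ 2) / n < M})
    (T : Finset (Fin p)) (αT σT : ℝ) (hσ : 0 < σT)
    (βT : Fin p → ℝ) (hβT : ∀ j ∈ T, βT j ≠ 0) (hβT' : ∀ j ∉ T, βT j = 0)
    (hT : T.Nonempty) (γ : Finset (Fin p)) (hγ : γ.Nonempty) (hγT : γ ≠ T)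
    (k ν : ℝ) (hk : 0 ≤ k) (hν₁ : -k < ν) (hν₂ : ν < 1)
    :
    (∀ δ' : ℝ, 0 < δ' →
      Tendsto (fun n : ℕ =>
        P {ω | 0 < RsqC (X n) γ (yResp (X n) αT βT σT (ε n ω)) ∧ RsqC (X n) γ (yResp (X n) αT βT σT (ε n ω)) < 1 ∧
               0 < RsqC (X n) T (yResp (X n) αT βT σT (ε n ω)) ∧ RsqC (X n) T (yResp (X n) αT βT σT (ε n ω)) < 1 ∧
               mixIntegral n k ν γ.card (RsqC (X n) γ (yResp (X n) αT βT σT (ε n ω))) /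
                   mixIntegral n k ν T.card (RsqC (X n) T (yResp (X n) αT βT σT (ε n ω))) ≤ δ'})
        atTop (nhds 1)) := by
  intro δ' hδ'
  refine tendsto_measure_one_of_measure_compl_le fun η hη => ?_
  obtain ⟨c, C, hc, hC, hX⟩ := eventually_design_bounds hA2
  obtain ⟨j₁, hj₁⟩ := hγ
  have hη6 : 0 < η / 6 := by positivity
  obtain ⟨M, hM, hMn⟩ := hA1 (η / 6) hη6
  set K := (p + 1 + C * ‖βT‖ ^ 2) / (η / 6) with hK
  have hK0 : 0 < K := by positivity
  have hηK : η / 6 * K = p + 1 + C * ‖βT‖ ^ 2 := mul_div_cancel₀ _ hη6.ne'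
  have hCβ0 : 0 ≤ C * ‖βT‖ ^ 2 := by positivity
  filter_upwards [hX, eventually_ge_atTop 2, eventually_ratio_le_of_noise_bounds (K := K)
    horth hc hC hX hσ hβT hβT' hT hγT hj₁ hk hν₁ hν₂ hM hδ' αT] with n hXn hn2 hgood
  have hn0 : 0 < n := by omega
  have hn : (0 : ℝ) < n := by exact_mod_cast hn0
  have hgram := isUnit_gram_of_lower_bound (c := c * n) (by positivity) fun v => (hXn v).1
  have hu : (fun i => X n i j₁) ≠ 0 := by
    intro h0
    have h1 := (hXn (Pi.single j₁ 1)).1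
    have h2 : X n *ᵥ Pi.single j₁ 1 = 0 := by
      rw [Matrix.mulVec_single_one]; exact h0
    have h3 : ‖(Pi.single j₁ 1 : Fin p → ℝ)‖ = 1 := by rw [Pi.norm_single, norm_one]
    rw [h2, h3, zero_dotProduct] at h1
    have : 0 < c * n := by positivity
    linarith
  have hm : (X n *ᵥ βT) ⬝ᵥ (X n *ᵥ βT) ≤ η / 6 * (K * n) := by
    refine (hXn βT).2.trans ?_
    rw [← mul_assoc, hηK, mul_right_comm]
    gcongr
    linarith [(Nat.cast_nonneg p : (0 : ℝ) ≤ p)]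
  have hd : (residProj (X n) γ *ᵥ (X n *ᵥ βT)) ⬝ᵥ (residProj (X n) γ *ᵥ (X n *ᵥ βT))
      ≤ η / 6 * (K * n) := by
    rw [residProj_mulVec_dotProduct_self (hgram γ)]
    refine le_trans (sub_le_self _ ?_) hm
    exact Finset.sum_nonneg fun i _ => mul_self_nonneg _
  have hz : P {ω | ε n ω = 0} = 0 := measure_eq_zero_eq_zero (fun c' hc' => by
    obtain ⟨M', hM', h⟩ := hA1 c' hc'
    exact ⟨M', hM', measure_not_norm_bounds_le (hmeas n) (h n hn0)⟩)
  have key := measure_not_noise_bounds_le (hmeas n) (hsph n) (hcov n) hn2 hgram T γ hu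
    (-((fun i => X n i j₁) ⬝ᵥ (X n *ᵥ βT)) / σT) hη6 hK0
    (measure_not_norm_bounds_le (hmeas n) (hMn n hn0)) hz (by linarith)
    (by linarith [(Nat.cast_nonneg p : (0 : ℝ) ≤ p)]) hm hd
  refine le_trans (measure_mono ?_) (key.trans_eq ?_)
  · exact fun ω hω h => hω (hgood (ε n ω) h)
  · congr 1; ring
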